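/- arXiv:1801.00661 — 3 statements merged into one kernel-verified Lean document; each statement's English description precedes it below -/
import Mathlib

section
/- Assume ν satisfies (N1) and (N2). Then for any n, m ∈ ℕ there exists a constant c = c(n,m) > 0 such that for all t > 0, ∫_{ℝ^n} e^{−t ψ(|z|)} |z|^m dz ≤ c · Ψ⁻¹(t⁻¹)^{n+m}, where Ψ⁻¹(u) := inf{s > 0 : Ψ(s) ≥ u} is the generalized inverse of Ψ. -/
open MeasureTheory Filter Set

attribute [local instance] Classical.propDecidable

/-- `φ̂(r) = r² / ∫₀^r s^{d+1} ν(s) ds` for `0 < r ≤ 1`, and `φ̂(r) = φ̂(1) r²` for `r > 1`. -/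
noncomputable def phiHat (d : ℕ) (ν : ℝ → ℝ) (r : ℝ) : ℝ :=
  if r ≤ 1 then r ^ 2 / ∫ s in Set.Ioo (0:ℝ) r, s ^ (d + 1) * ν s
  else (1 / ∫ s in Set.Ioo (0:ℝ) 1, s ^ (d + 1) * ν s) * r ^ 2

/-- `ν₁(r) = -ν′(r) / (2π r)`. -/
noncomputable def nu1 (ν : ℝ → ℝ) (r : ℝ) : ℝ := -(deriv ν r) / (2 * Real.pi * r)

/-- The radial characteristic exponent of the symmetric Lévy measure `ν(|z|)dz`:
`ψ(ρ) = ∫_{ℝ^d} (1 - cos(ρ z₁)) ν(|z|) dz`. -/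
noncomputable def psi (d : ℕ) (hd : 0 < d) (ν : ℝ → ℝ) (ρ : ℝ) : ℝ :=
  ∫ z : EuclideanSpace ℝ (Fin d), (1 - Real.cos (ρ * z ⟨0, hd⟩)) * ν ‖z‖

/-- `Ψ(r) = sup_{0 < s ≤ r} ψ(s)`. -/
noncomputable def Psi (d : ℕ) (hd : 0 < d) (ν : ℝ → ℝ) (r : ℝ) : ℝ :=
  sSup (psi d hd ν '' Set.Ioc 0 r)

/-- Generalized inverse `Ψ⁻¹(u) = inf{s > 0 : Ψ(s) ≥ u}`. -/
noncomputable def PsiInv (d : ℕ) (hd : 0 < d) (ν : ℝ → ℝ) (u : ℝ) : ℝ :=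
  sInf {s : ℝ | 0 < s ∧ u ≤ Psi d hd ν s}

/-- `f(r) = φ̂(1)/(r^{d+1} φ̂(r))` for `0 < r ≤ 1`, `f(r) = r^{-ℓ-1} e^{-b r^β}` for `r > 1`. -/
noncomputable def ffun (d : ℕ) (ν : ℝ → ℝ) (b β ℓ : ℝ) (r : ℝ) : ℝ :=
  if r ≤ 1 then phiHat d ν 1 / (r ^ (d + 1) * phiHat d ν r)
  else r ^ (-ℓ - 1) * Real.exp (-b * r ^ β)

/-- `f̃(r) = φ̂(1)/(r^d φ̂(r))` for `0 < r ≤ 1`, `f̃(r) = r^{-ℓ} e^{-b r^β}` for `r > 1`. -/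
noncomputable def ftil (d : ℕ) (ν : ℝ → ℝ) (b β ℓ : ℝ) (r : ℝ) : ℝ :=
  if r ≤ 1 then phiHat d ν 1 / (r ^ d * phiHat d ν r)
  else r ^ (-ℓ) * Real.exp (-b * r ^ β)

structure NuAssumptions (d : ℕ) (ν : ℝ → ℝ) (a b β ℓ a₃ α₃ : ℝ) : Prop where
  ν_pos : ∀ r : ℝ, 0 < r → 0 < ν r
  ν_anti : AntitoneOn ν (Set.Ioi 0)
  ν_diff : ∀ r : ℝ, 0 < r → DifferentiableAt ℝ ν r
  ν_int : MeasureTheory.Integrable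
      (fun y : EuclideanSpace ℝ (Fin d) => min 1 (‖y‖ ^ 2) * ν ‖y‖)
  ha : 0 < a
  hb : 0 < b
  β_pos : 0 < β
  β_le : β ≤ 1
  ℓ_nonneg : 0 ≤ ℓ
  hN1 : ∀ r : ℝ, 1 < r → ν r ≤ a * r ^ (-ℓ) * Real.exp (-b * r ^ β)
  a₃_pos : 0 < a₃
  α₃_pos : 0 < α₃
  α₃_le : α₃ ≤ 2
  hN2 : ∀ r R : ℝ, 0 < r → r ≤ R → a₃ * (R / r) ^ α₃ ≤ phiHat d ν R / phiHat d ν r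

/-- The truncated radial moment `∫₀^r s^{d+1} ν(s) ds`. -/
noncomputable def radialMoment (d : ℕ) (ν : ℝ → ℝ) (r : ℝ) : ℝ :=
  ∫ s in Ioo (0 : ℝ) r, s ^ (d + 1) * ν s

/-- The reciprocal of `phiHat` on `(0, ∞)`. -/
noncomputable def invPhiHat (d : ℕ) (ν : ℝ → ℝ) (r : ℝ) : ℝ :=
  radialMoment d ν (min r 1) / r ^ 2

theorem phiHat_eq_inv (d : ℕ) (ν : ℝ → ℝ) (r : ℝ) : phiHat d ν r = (invPhiHat d ν r)⁻¹ := by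
  unfold phiHat invPhiHat radialMoment
  split_ifs with h
  · rw [min_eq_left h, inv_div]
  · rw [min_eq_right (not_le.mp h).le, inv_div]
    ring

theorem integral_radial {d : ℕ} (hd : 0 < d) (f : ℝ → ℝ) :
    ∫ z : EuclideanSpace ℝ (Fin d), f ‖z‖ =
      d * (volume.real (Metric.ball (0 : EuclideanSpace ℝ (Fin d)) 1) *
        ∫ s in Ioi (0 : ℝ), s ^ (d - 1) * f s) := by
  have : Nonempty (Fin d) := ⟨⟨0, hd⟩⟩
  have h := integral_fun_norm_addHaar (volume : Measure (EuclideanSpace ℝ (Fin d))) f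
  simpa using h

theorem integrable_radial_iff {d : ℕ} (hd : 0 < d) (f : ℝ → ℝ) :
    Integrable (fun z : EuclideanSpace ℝ (Fin d) => f ‖z‖) ↔
      IntegrableOn (fun s : ℝ => s ^ (d - 1) * f s) (Ioi 0) := by
  have : Nonempty (Fin d) := ⟨⟨0, hd⟩⟩
  have h := integrable_fun_norm_addHaar (volume : Measure (EuclideanSpace ℝ (Fin d))) (f := f)
  simpa using h

theorem volume_real_unitBall_pos (d : ℕ) :
    0 < volume.real (Metric.ball (0 : EuclideanSpace ℝ (Fin d)) 1) :=
  ENNReal.toReal_pos (Metric.measure_ball_pos _ _ one_pos).ne' measure_ball_lt_top.ne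

theorem sq_coord_le_sq_norm {d : ℕ} (z : EuclideanSpace ℝ (Fin d)) (i : Fin d) :
    z i ^ 2 ≤ ‖z‖ ^ 2 := by
  rw [EuclideanSpace.real_norm_sq_eq]
  exact Finset.single_le_sum (f := fun j => z j ^ 2) (fun j _ => sq_nonneg _) (Finset.mem_univ i)

theorem integrable_sq_coord_mul_radial {d : ℕ} {g : ℝ → ℝ}
    (hg : Integrable fun z : EuclideanSpace ℝ (Fin d) => ‖z‖ ^ 2 * g ‖z‖) (i : Fin d) :
    Integrable fun z : EuclideanSpace ℝ (Fin d) => z i ^ 2 * g ‖z‖ := by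
  have h := hg.bdd_mul (c := 1)
    (f := fun z : EuclideanSpace ℝ (Fin d) => z i ^ 2 / ‖z‖ ^ 2)
    (by fun_prop : Measurable _).aestronglyMeasurable
    (Eventually.of_forall fun z => by
      rw [Real.norm_of_nonneg (by positivity)]
      exact div_le_one_of_le₀ (sq_coord_le_sq_norm z i) (by positivity))
  refine h.congr (Eventually.of_forall fun z => ?_)
  rcases eq_or_ne z 0 with rfl | hz
  · simp
  · have : ‖z‖ ≠ 0 := norm_ne_zero_iff.mpr hz
    simp only
    field_simp

theorem integral_sq_coord_mul_radial_eq {d : ℕ} (g : ℝ → ℝ) (i j : Fin d) :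
    ∫ z : EuclideanSpace ℝ (Fin d), z i ^ 2 * g ‖z‖ =
      ∫ z : EuclideanSpace ℝ (Fin d), z j ^ 2 * g ‖z‖ := by
  let e := LinearIsometryEquiv.piLpCongrLeft 2 ℝ ℝ (Equiv.swap i j)
  have h := e.measurePreserving.integral_comp e.toHomeomorph.measurableEmbedding
    (fun z : EuclideanSpace ℝ (Fin d) => z i ^ 2 * g ‖z‖)
  rw [← h]
  refine integral_congr_ae (Eventually.of_forall fun z => ?_)
  have hz : e z i = z j := by
    simp [e, LinearIsometryEquiv.piLpCongrLeft_apply, Equiv.piCongrLeft']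
  simp only [hz, LinearIsometryEquiv.norm_map]

/-- By symmetry each coordinate carries an equal share of a radial second moment. -/
theorem integral_sq_norm_mul_radial {d : ℕ} {g : ℝ → ℝ}
    (hg : Integrable fun z : EuclideanSpace ℝ (Fin d) => ‖z‖ ^ 2 * g ‖z‖) (i : Fin d) :
    ∫ z : EuclideanSpace ℝ (Fin d), ‖z‖ ^ 2 * g ‖z‖ =
      d * ∫ z : EuclideanSpace ℝ (Fin d), z i ^ 2 * g ‖z‖ := by
  simp_rw [EuclideanSpace.real_norm_sq_eq, Finset.sum_mul]
  rw [integral_finsetSum _ fun j _ => integrable_sq_coord_mul_radial hg j]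
  simp [integral_sq_coord_mul_radial_eq g _ i]

section

variable {d : ℕ} {ν : ℝ → ℝ} {a b β ℓ a₃ α₃ : ℝ}

theorem NuAssumptions.integrableOn_radial_Ioo (H : NuAssumptions d ν a b β ℓ a₃ α₃) (hd : 0 < d) :
    IntegrableOn (fun s : ℝ => s ^ (d + 1) * ν s) (Ioo 0 1) := by
  have h := (integrable_radial_iff hd fun s => min 1 (s ^ 2) * ν s).mp H.ν_int
  refine (h.mono_set Ioo_subset_Ioi_self).congr_fun (fun s hs => ?_) measurableSet_Ioo
  obtain ⟨k, rfl⟩ : ∃ k, d = k + 1 := ⟨d - 1, by omega⟩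
  have : s ^ 2 ≤ 1 := pow_le_one₀ hs.1.le hs.2.le
  simp only [min_eq_right this, Nat.add_sub_cancel]
  ring

theorem NuAssumptions.integrableOn_radial_Ici (H : NuAssumptions d ν a b β ℓ a₃ α₃) :
    IntegrableOn (fun s : ℝ => s ^ (d + 1) * ν s) (Ici 1) := by
  rw [integrableOn_Ici_iff_integrableOn_Ioi]
  have h := ((integrableOn_rpow_mul_exp_neg_mul_rpow (s := ((d + 1 : ℕ) : ℝ))
    (by linarith [Nat.cast_nonneg (α := ℝ) (d + 1)]) H.β_pos H.hb).mono_set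
    (Ioi_subset_Ioi zero_le_one)).const_mul a
  refine h.mono' ?_ ?_
  · refine ContinuousOn.aestronglyMeasurable (fun s hs => ?_) measurableSet_Ioi
    exact ((continuousAt_id.pow _).mul
      (H.ν_diff s (zero_lt_one.trans hs)).continuousAt).continuousWithinAt
  · refine (ae_restrict_mem measurableSet_Ioi).mono fun s hs => ?_
    have hs1 : (1 : ℝ) < s := hs
    have hs0 : 0 < s := zero_lt_one.trans hs1
    have h1 := H.hN1 s hs1
    have h2 : s ^ (-ℓ) ≤ 1 := Real.rpow_le_one_of_one_le_of_nonpos hs1.le (by linarith [H.ℓ_nonneg])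
    have := H.ν_pos s hs0
    have := H.ha
    rw [Real.norm_of_nonneg (by positivity), Real.rpow_natCast]
    calc s ^ (d + 1) * ν s ≤ s ^ (d + 1) * (a * 1 * Real.exp (-b * s ^ β)) := by
          gcongr
          exact h1.trans (by gcongr)
      _ = _ := by ring

theorem NuAssumptions.le_radialMoment (H : NuAssumptions d ν a b β ℓ a₃ α₃) (hd : 0 < d)
    {r : ℝ} (hr : 0 < r) (hr1 : r ≤ 1) :
    ν r * r ^ (d + 2) / (d + 2) ≤ radialMoment d ν r := by
  have h : ∫ s in Ioo (0 : ℝ) r, s ^ (d + 1) * ν r = ν r * r ^ (d + 2) / (d + 2) := by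
    rw [integral_mul_const, ← integral_Ioc_eq_integral_Ioo, ← intervalIntegral.integral_of_le hr.le,
      integral_pow]
    push_cast
    simp only [ne_eq, Nat.add_eq_zero_iff, one_ne_zero, and_false, not_false_eq_true, zero_pow]
    ring
  rw [← h]
  refine setIntegral_mono_on ?_ ((H.integrableOn_radial_Ioo hd).mono_set
    (Ioo_subset_Ioo_right hr1)) measurableSet_Ioo fun s hs => ?_
  · exact (((continuous_pow _).mul continuous_const).integrableOn_Icc (a := 0) (b := r)).mono_set
      Ioo_subset_Icc_self
  · have := hs.1
    gcongr
    exact H.ν_anti hs.1 hr hs.2.le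

theorem NuAssumptions.invPhiHat_pos (H : NuAssumptions d ν a b β ℓ a₃ α₃) (hd : 0 < d)
    {r : ℝ} (hr : 0 < r) : 0 < invPhiHat d ν r := by
  have h0 : 0 < min r 1 := lt_min hr one_pos
  have h := H.le_radialMoment hd h0 (min_le_right _ _)
  have := H.ν_pos _ h0
  refine div_pos (lt_of_lt_of_le (by positivity) h) (by positivity)

theorem NuAssumptions.invPhiHat_scaling (H : NuAssumptions d ν a b β ℓ a₃ α₃) (hd : 0 < d)
    {r R : ℝ} (hr : 0 < r) (hrR : r ≤ R) :
    a₃ * (R / r) ^ α₃ * invPhiHat d ν R ≤ invPhiHat d ν r := by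
  have h := H.hN2 r R hr hrR
  have hR := H.invPhiHat_pos hd (hr.trans_le hrR)
  rwa [phiHat_eq_inv, phiHat_eq_inv, inv_div_inv, le_div_iff₀ hR] at h

theorem NuAssumptions.invPhiHat_almost_antitone (H : NuAssumptions d ν a b β ℓ a₃ α₃) (hd : 0 < d)
    {r R : ℝ} (hr : 0 < r) (hrR : r ≤ R) : a₃ * invPhiHat d ν R ≤ invPhiHat d ν r := by
  refine le_trans ?_ (H.invPhiHat_scaling hd hr hrR)
  have hR := H.invPhiHat_pos hd (hr.trans_le hrR)
  have h1 : 1 ≤ (R / r) ^ α₃ :=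
    Real.one_le_rpow ((one_le_div hr).mpr hrR) H.α₃_pos.le
  have := H.a₃_pos
  calc a₃ * invPhiHat d ν R = a₃ * 1 * invPhiHat d ν R := by ring
    _ ≤ _ := by gcongr

theorem NuAssumptions.psi_integrand_nonneg (H : NuAssumptions d ν a b β ℓ a₃ α₃) (i : Fin d)
    (ρ : ℝ) (z : EuclideanSpace ℝ (Fin d)) : 0 ≤ (1 - Real.cos (ρ * z i)) * ν ‖z‖ := by
  rcases eq_or_ne z 0 with rfl | hz
  · simp
  · exact mul_nonneg (by linarith [Real.cos_le_one (ρ * z i)])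
      (H.ν_pos _ (norm_pos_iff.mpr hz)).le

theorem NuAssumptions.psi_nonneg (H : NuAssumptions d ν a b β ℓ a₃ α₃) (hd : 0 < d) (ρ : ℝ) :
    0 ≤ psi d hd ν ρ :=
  integral_nonneg (H.psi_integrand_nonneg _ ρ)

theorem one_sub_cos_le_two_mul_min (x : ℝ) : 1 - Real.cos x ≤ 2 * min 1 (x ^ 2) := by
  rw [mul_min_of_nonneg _ _ zero_le_two]
  refine le_min ?_ ?_
  · linarith [Real.neg_one_le_cos x]
  · linarith [Real.one_sub_sq_div_two_le_cos (x := x), sq_nonneg x]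

theorem one_sub_cos_coord_le (ρ : ℝ) (z : EuclideanSpace ℝ (Fin d)) (i : Fin d) :
    1 - Real.cos (ρ * z i) ≤ 2 * min 1 (ρ ^ 2 * ‖z‖ ^ 2) := by
  refine (one_sub_cos_le_two_mul_min _).trans ?_
  rw [mul_pow]
  gcongr 2 * min 1 (_ * ?_)
  exact sq_coord_le_sq_norm z i

theorem min_one_mul_le (ρ x : ℝ) :
    min 1 (ρ ^ 2 * x ^ 2) ≤ (1 + ρ ^ 2) * min 1 (x ^ 2) := by
  rcases le_total 1 (x ^ 2) with h | h
  · rw [min_eq_left h]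
    exact (min_le_left _ _).trans (by nlinarith [sq_nonneg ρ])
  · rw [min_eq_right h]
    exact (min_le_right _ _).trans (by nlinarith [sq_nonneg x])

theorem NuAssumptions.integrable_min_mul (H : NuAssumptions d ν a b β ℓ a₃ α₃) (ρ : ℝ) :
    Integrable fun z : EuclideanSpace ℝ (Fin d) => min 1 (ρ ^ 2 * ‖z‖ ^ 2) * ν ‖z‖ := by
  have h := H.ν_int.bdd_mul (c := 1 + ρ ^ 2)
    (f := fun z : EuclideanSpace ℝ (Fin d) => min 1 (ρ ^ 2 * ‖z‖ ^ 2) / min 1 (‖z‖ ^ 2))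
    (by fun_prop : Measurable _).aestronglyMeasurable
    (Eventually.of_forall fun z => by
      rw [Real.norm_of_nonneg (by positivity)]
      exact div_le_of_le_mul₀ (by positivity) (by positivity) (min_one_mul_le _ _))
  refine h.congr (Eventually.of_forall fun z => ?_)
  rcases eq_or_ne z 0 with rfl | hz
  · simp
  · have h1 : 0 < ‖z‖ := norm_pos_iff.mpr hz
    have h2 : min 1 (‖z‖ ^ 2) ≠ 0 := by positivity
    simp only
    field_simp

theorem NuAssumptions.integrable_psi_integrand (H : NuAssumptions d ν a b β ℓ a₃ α₃)
    (i : Fin d) (ρ : ℝ) :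
    Integrable fun z : EuclideanSpace ℝ (Fin d) => (1 - Real.cos (ρ * z i)) * ν ‖z‖ := by
  have h := (H.integrable_min_mul ρ).bdd_mul (c := 2)
    (f := fun z : EuclideanSpace ℝ (Fin d) =>
      (1 - Real.cos (ρ * z i)) / min 1 (ρ ^ 2 * ‖z‖ ^ 2))
    (by fun_prop : Measurable _).aestronglyMeasurable
    (Eventually.of_forall fun z => by
      have : 0 ≤ 1 - Real.cos (ρ * z i) := by linarith [Real.cos_le_one (ρ * z i)]
      rw [Real.norm_of_nonneg (by positivity)]
      exact div_le_of_le_mul₀ (by positivity) (by positivity) (one_sub_cos_coord_le _ _ _))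
  refine h.congr (Eventually.of_forall fun z => ?_)
  rcases eq_or_ne z 0 with rfl | hz
  · simp
  rcases eq_or_ne ρ 0 with rfl | hρ
  · simp
  · have h1 : 0 < ‖z‖ := norm_pos_iff.mpr hz
    have h2 : min 1 (ρ ^ 2 * ‖z‖ ^ 2) ≠ 0 := by positivity
    simp only
    field_simp

theorem NuAssumptions.psi_ge (H : NuAssumptions d ν a b β ℓ a₃ α₃) (hd : 0 < d) :
    ∃ c : ℝ, 0 < c ∧ ∀ ρ : ℝ, 0 < ρ → c * invPhiHat d ν ρ⁻¹ ≤ psi d hd ν ρ := by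
  refine ⟨2 / Real.pi ^ 2 * volume.real (Metric.ball (0 : EuclideanSpace ℝ (Fin d)) 1),
    mul_pos (by positivity) (volume_real_unitBall_pos d), fun ρ hρ => ?_⟩
  set q := min ρ⁻¹ 1 with hq
  set g : ℝ → ℝ := (Iio q).indicator ν with hgdef
  have hsq : ∀ s ∈ Ioi (0 : ℝ), (Ioo 0 q).indicator (fun s => s ^ (d + 1) * ν s) s =
      s ^ (d - 1) * (s ^ 2 * g s) := by
    intro s hs
    obtain ⟨k, rfl⟩ : ∃ k, d = k + 1 := ⟨d - 1, by omega⟩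
    have hs0 : 0 < s := hs
    by_cases h : s < q
    · simp only [hgdef, indicator, mem_Ioo, mem_Iio, hs0, h, and_self, if_true,
        Nat.add_sub_cancel]
      ring
    · simp [hgdef, indicator, h]
  have hIoo : IntegrableOn (fun s : ℝ => s ^ (d + 1) * ν s) (Ioo 0 q) :=
    (H.integrableOn_radial_Ioo hd).mono_set (Ioo_subset_Ioo_right (min_le_right _ _))
  have hint : Integrable fun z : EuclideanSpace ℝ (Fin d) => ‖z‖ ^ 2 * g ‖z‖ := by
    rw [integrable_radial_iff hd fun s => s ^ 2 * g s]
    exact ((integrable_indicator_iff measurableSet_Ioo).mpr hIoo).integrableOn.congr_fun hsq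
      measurableSet_Ioi
  have hval : ∫ z : EuclideanSpace ℝ (Fin d), z ⟨0, hd⟩ ^ 2 * g ‖z‖ =
      volume.real (Metric.ball (0 : EuclideanSpace ℝ (Fin d)) 1) * radialMoment d ν q := by
    have h1 := integral_sq_norm_mul_radial hint ⟨0, hd⟩
    rw [integral_radial hd fun s => s ^ 2 * g s,
      ← setIntegral_congr_fun measurableSet_Ioi hsq, setIntegral_indicator measurableSet_Ioo,
      inter_eq_right.mpr Ioo_subset_Ioi_self] at h1
    exact (mul_left_cancel₀ (Nat.cast_ne_zero.mpr hd.ne') h1).symm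
  calc 2 / Real.pi ^ 2 * volume.real (Metric.ball (0 : EuclideanSpace ℝ (Fin d)) 1) *
        invPhiHat d ν ρ⁻¹
      = ∫ z : EuclideanSpace ℝ (Fin d), 2 / Real.pi ^ 2 * ρ ^ 2 *
          (z ⟨0, hd⟩ ^ 2 * g ‖z‖) := by
        rw [integral_const_mul, hval, invPhiHat, ← hq, inv_pow, div_inv_eq_mul]
        ring
    _ ≤ psi d hd ν ρ := by
        refine integral_mono ((integrable_sq_coord_mul_radial hint _).const_mul _)
          (H.integrable_psi_integrand _ ρ) fun z => ?_
        have h0 := H.psi_integrand_nonneg ⟨0, hd⟩ ρ z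
        by_cases hz : ‖z‖ < q
        · rcases eq_or_ne z 0 with rfl | hz0
          · simp
          have hν := H.ν_pos _ (norm_pos_iff.mpr hz0)
          have hx : |ρ * z ⟨0, hd⟩| ≤ Real.pi := by
            have h1 : |z ⟨0, hd⟩| ≤ ‖z‖ := PiLp.norm_apply_le z _
            have h2 : ‖z‖ ≤ ρ⁻¹ := hz.le.trans (min_le_left _ _)
            rw [abs_mul, abs_of_pos hρ]
            calc ρ * |z ⟨0, hd⟩| ≤ ρ * ρ⁻¹ := by gcongr; exact h1.trans h2
              _ = 1 := mul_inv_cancel₀ hρ.ne'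
              _ ≤ Real.pi := by linarith [Real.pi_gt_three]
          have h3 := Real.cos_le_one_sub_mul_cos_sq hx
          have hg : g ‖z‖ = ν ‖z‖ := indicator_of_mem (mem_Iio.mpr hz) ν
          simp only [hg]
          nlinarith
        · have hg : g ‖z‖ = 0 := indicator_of_notMem (mt mem_Iio.mp hz) ν
          simpa [hg] using h0

theorem NuAssumptions.pow_mul_nu_le (H : NuAssumptions d ν a b β ℓ a₃ α₃) (hd : 0 < d)
    {r s : ℝ} (hr : 0 < r) (hrs : r ≤ s) (hs1 : s ≤ 1) :
    s ^ (d - 1) * ν s ≤ s ^ (-1 - α₃) * ((d + 2) / a₃ * r ^ α₃ * invPhiHat d ν r) := by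
  have hs : 0 < s := hr.trans_le hrs
  have ha₃ := H.a₃_pos
  have h1 : ν s * s ^ (d + 2) ≤ (d + 2) * radialMoment d ν s := by
    have := H.le_radialMoment hd hs hs1
    rw [div_le_iff₀ (by positivity)] at this
    linarith
  have h2 := H.invPhiHat_scaling hd hr hrs
  have h3 : radialMoment d ν s = invPhiHat d ν s * s ^ 2 := by
    rw [invPhiHat, min_eq_left hs1]
    field_simp
  rw [Real.div_rpow hs.le hr.le] at h2
  rw [Real.rpow_sub hs, Real.rpow_neg_one]
  have hsα : 0 < s ^ α₃ := Real.rpow_pos_of_pos hs _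
  have hrα : 0 < r ^ α₃ := Real.rpow_pos_of_pos hr _
  have h4 : invPhiHat d ν s ≤ r ^ α₃ * invPhiHat d ν r / (a₃ * s ^ α₃) := by
    rw [le_div_iff₀ (by positivity)]
    calc invPhiHat d ν s * (a₃ * s ^ α₃)
        = r ^ α₃ * (a₃ * (s ^ α₃ / r ^ α₃) * invPhiHat d ν s) := by field_simp
      _ ≤ _ := by gcongr
  have h5 : s ^ (d - 1) * ν s * s ≤ (d + 2) * invPhiHat d ν s := by
    obtain ⟨k, rfl⟩ : ∃ k, d = k + 1 := ⟨d - 1, by omega⟩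
    refine le_of_mul_le_mul_right ?_ (pow_pos hs 2)
    rw [h3] at h1
    calc s ^ (k + 1 - 1) * ν s * s * s ^ 2 = ν s * s ^ (k + 1 + 2) := by
          rw [Nat.add_sub_cancel]
          ring
      _ ≤ _ := h1
      _ = _ := by ring
  calc s ^ (d - 1) * ν s = s ^ (d - 1) * ν s * s / s := by field_simp
    _ ≤ (d + 2) * (r ^ α₃ * invPhiHat d ν r / (a₃ * s ^ α₃)) / s := by
        refine div_le_div_of_nonneg_right (h5.trans ?_) hs.le
        gcongr
    _ = _ := by field_simp

theorem min_one_inv_sq_mul_le {r s : ℝ} (hs : 1 ≤ s) :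
    min 1 (r⁻¹ ^ 2 * s ^ 2) ≤ (max r 1)⁻¹ ^ 2 * s ^ 2 := by
  rcases le_total r 1 with h | h
  · rw [max_eq_right h]
    refine (min_le_left _ _).trans ?_
    rw [inv_one, one_pow, one_mul]
    exact one_le_pow₀ hs
  · rw [max_eq_left h]
    exact min_le_right _ _

theorem NuAssumptions.inv_sq_max_le (H : NuAssumptions d ν a b β ℓ a₃ α₃) (hd : 0 < d)
    {r : ℝ} (hr : 0 < r) :
    (max r 1)⁻¹ ^ 2 ≤ (invPhiHat d ν 1 * a₃)⁻¹ * invPhiHat d ν r := by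
  have h1 := H.invPhiHat_pos hd one_pos
  have h := H.invPhiHat_almost_antitone hd hr (le_max_left r 1)
  have h2 : invPhiHat d ν (max r 1) = invPhiHat d ν 1 * (max r 1)⁻¹ ^ 2 := by
    simp [invPhiHat, div_eq_mul_inv]
  have ha₃ := H.a₃_pos
  rw [h2] at h
  rw [inv_mul_eq_div, le_div_iff₀ (by positivity)]
  linarith

theorem NuAssumptions.radial_integral_le (H : NuAssumptions d ν a b β ℓ a₃ α₃) (hd : 0 < d) :
    ∃ c : ℝ, 0 < c ∧ ∀ r : ℝ, 0 < r →
      ∫ s in Ioi (0 : ℝ), s ^ (d - 1) * (min 1 (r⁻¹ ^ 2 * s ^ 2) * ν s) ≤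
        c * invPhiHat d ν r := by
  set M := ∫ s in Ici (1 : ℝ), s ^ (d + 1) * ν s
  have ha₃ := H.a₃_pos
  have hα₃ := H.α₃_pos
  have hG1 := H.invPhiHat_pos hd one_pos
  have hM0 : 0 ≤ M := setIntegral_nonneg measurableSet_Ici fun s (hs : 1 ≤ s) => by
    have := H.ν_pos s (by linarith)
    positivity
  refine ⟨1 + (d + 2) / a₃ / α₃ + M * (invPhiHat d ν 1 * a₃)⁻¹, by positivity, fun r hr => ?_⟩
  set G := invPhiHat d ν r with hG
  have hGpos : 0 < G := H.invPhiHat_pos hd hr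
  set q := min r 1
  have hIoo : IntegrableOn (fun s : ℝ => s ^ (d + 1) * ν s) (Ioo 0 q) :=
    (H.integrableOn_radial_Ioo hd).mono_set (Ioo_subset_Ioo_right (min_le_right _ _))
  have hpow : IntegrableOn (fun s : ℝ => s ^ (-1 - α₃)) (Ici r) := by
    rw [integrableOn_Ici_iff_integrableOn_Ioi]
    exact integrableOn_Ioi_rpow_of_lt (by linarith) hr
  have hrα : 0 < r ^ α₃ := Real.rpow_pos_of_pos hr _
  have hpow_val : ∫ s in Ici r, s ^ (-1 - α₃) = (r ^ α₃)⁻¹ / α₃ := by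
    rw [integral_Ici_eq_integral_Ioi, integral_Ioi_rpow_of_lt (by linarith) hr,
      show -1 - α₃ + 1 = -α₃ by ring, Real.rpow_neg hr.le, neg_div_neg_eq]
  let F₁ : ℝ → ℝ := (Ioo 0 q).indicator fun s => s ^ (d + 1) * ν s
  let F₂ : ℝ → ℝ := (Ici r).indicator fun s => s ^ (-1 - α₃)
  let F₃ : ℝ → ℝ := (Ici 1).indicator fun s => s ^ (d + 1) * ν s
  have i₁ : IntegrableOn (fun s => F₁ s * r⁻¹ ^ 2) (Ioi 0) :=
    (((integrable_indicator_iff measurableSet_Ioo).mpr hIoo).mul_const _).integrableOn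
  have i₂ : IntegrableOn (fun s => F₂ s * ((d + 2) / a₃ * r ^ α₃ * G)) (Ioi 0) :=
    (((integrable_indicator_iff measurableSet_Ici).mpr hpow).mul_const _).integrableOn
  have i₃ : IntegrableOn (fun s => F₃ s * (max r 1)⁻¹ ^ 2) (Ioi 0) :=
    (((integrable_indicator_iff measurableSet_Ici).mpr
      H.integrableOn_radial_Ici).mul_const _).integrableOn
  have i₁₂ : IntegrableOn (fun s => F₁ s * r⁻¹ ^ 2 + F₂ s * ((d + 2) / a₃ * r ^ α₃ * G))
      (Ioi 0) := i₁.add i₂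
  have hF₁ : ∀ s, 0 ≤ F₁ s := indicator_nonneg fun s hs => by
    have := H.ν_pos s hs.1
    have := hs.1
    positivity
  have hF₂ : ∀ s, 0 ≤ F₂ s := indicator_nonneg fun s hs =>
    Real.rpow_nonneg (hr.le.trans hs) _
  have hF₃ : ∀ s, 0 ≤ F₃ s := indicator_nonneg fun s (hs : 1 ≤ s) => by
    have := H.ν_pos s (by linarith)
    positivity
  have hpt : ∀ s ∈ Ioi (0 : ℝ), s ^ (d - 1) * (min 1 (r⁻¹ ^ 2 * s ^ 2) * ν s) ≤
      F₁ s * r⁻¹ ^ 2 + F₂ s * ((d + 2) / a₃ * r ^ α₃ * G) + F₃ s * (max r 1)⁻¹ ^ 2 := by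
    intro s hs
    have hs0 : 0 < s := hs
    have hν := H.ν_pos s hs0
    have hadd : s ^ (d - 1) * s ^ 2 = s ^ (d + 1) := by
      rw [← pow_add]
      congr 1
      omega
    have n₁ : 0 ≤ F₁ s * r⁻¹ ^ 2 := mul_nonneg (hF₁ s) (by positivity)
    have n₂ : 0 ≤ F₂ s * ((d + 2) / a₃ * r ^ α₃ * G) := mul_nonneg (hF₂ s) (by positivity)
    have n₃ : 0 ≤ F₃ s * (max r 1)⁻¹ ^ 2 := mul_nonneg (hF₃ s) (by positivity)
    by_cases hsq : s < q
    · have e₁ : F₁ s = s ^ (d + 1) * ν s := indicator_of_mem (mem_Ioo.mpr ⟨hs0, hsq⟩) _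
      have : s ^ (d - 1) * (min 1 (r⁻¹ ^ 2 * s ^ 2) * ν s) ≤ F₁ s * r⁻¹ ^ 2 := by
        calc s ^ (d - 1) * (min 1 (r⁻¹ ^ 2 * s ^ 2) * ν s)
            ≤ s ^ (d - 1) * ((r⁻¹ ^ 2 * s ^ 2) * ν s) := by
              gcongr
              exact min_le_right _ _
          _ = F₁ s * r⁻¹ ^ 2 := by
              rw [e₁, ← hadd]
              ring
      linarith
    rcases le_or_gt 1 s with h1 | h1
    · have e₃ : F₃ s = s ^ (d + 1) * ν s := indicator_of_mem (mem_Ici.mpr h1) _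
      have : s ^ (d - 1) * (min 1 (r⁻¹ ^ 2 * s ^ 2) * ν s) ≤ F₃ s * (max r 1)⁻¹ ^ 2 := by
        calc s ^ (d - 1) * (min 1 (r⁻¹ ^ 2 * s ^ 2) * ν s)
            ≤ s ^ (d - 1) * (((max r 1)⁻¹ ^ 2 * s ^ 2) * ν s) := by
              gcongr
              exact min_one_inv_sq_mul_le h1
          _ = F₃ s * (max r 1)⁻¹ ^ 2 := by
              rw [e₃, ← hadd]
              ring
      linarith
    · have hrs : r ≤ s := by
        rcases min_le_iff.mp (not_lt.mp hsq) with h | h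
        · exact h
        · linarith
      have e₂ : F₂ s = s ^ (-1 - α₃) := indicator_of_mem (mem_Ici.mpr hrs) _
      have : s ^ (d - 1) * (min 1 (r⁻¹ ^ 2 * s ^ 2) * ν s) ≤
          F₂ s * ((d + 2) / a₃ * r ^ α₃ * G) := by
        calc s ^ (d - 1) * (min 1 (r⁻¹ ^ 2 * s ^ 2) * ν s) ≤ s ^ (d - 1) * (1 * ν s) := by
              gcongr
              exact min_le_left _ _
          _ = s ^ (d - 1) * ν s := by rw [one_mul]
          _ ≤ _ := by
              rw [e₂]
              exact H.pow_mul_nu_le hd hr hrs h1.le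
      linarith
  have v₁ : ∫ s in Ioi (0 : ℝ), F₁ s = radialMoment d ν q := by
    rw [setIntegral_indicator measurableSet_Ioo, inter_eq_right.mpr Ioo_subset_Ioi_self,
      radialMoment]
  have v₂ : ∫ s in Ioi (0 : ℝ), F₂ s = (r ^ α₃)⁻¹ / α₃ := by
    rw [setIntegral_indicator measurableSet_Ici, inter_eq_right.mpr (Ici_subset_Ioi.mpr hr),
      hpow_val]
  have v₃ : ∫ s in Ioi (0 : ℝ), F₃ s = M := by
    rw [setIntegral_indicator measurableSet_Ici, inter_eq_right.mpr (Ici_subset_Ioi.mpr one_pos)]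
  calc ∫ s in Ioi (0 : ℝ), s ^ (d - 1) * (min 1 (r⁻¹ ^ 2 * s ^ 2) * ν s)
      ≤ ∫ s in Ioi (0 : ℝ), (F₁ s * r⁻¹ ^ 2 + F₂ s * ((d + 2) / a₃ * r ^ α₃ * G) +
          F₃ s * (max r 1)⁻¹ ^ 2) := by
        refine integral_mono_of_nonneg ?_ (i₁₂.add i₃) ?_
        · refine (ae_restrict_mem measurableSet_Ioi).mono fun s hs => ?_
          have := H.ν_pos s hs
          have : 0 < s := hs
          simp only [Pi.zero_apply]
          positivity
        · exact (ae_restrict_mem measurableSet_Ioi).mono hpt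
    _ = radialMoment d ν q * r⁻¹ ^ 2 + (r ^ α₃)⁻¹ / α₃ * ((d + 2) / a₃ * r ^ α₃ * G) +
          M * (max r 1)⁻¹ ^ 2 := by
        rw [integral_add i₁₂ i₃, integral_add i₁ i₂, integral_mul_const,
          integral_mul_const, integral_mul_const, v₁, v₂, v₃]
    _ ≤ G + (d + 2) / a₃ / α₃ * G + M * ((invPhiHat d ν 1 * a₃)⁻¹ * G) := by
        refine add_le_add (add_le_add (le_of_eq ?_) (le_of_eq (by field_simp)))
          (mul_le_mul_of_nonneg_left (H.inv_sq_max_le hd hr) hM0)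
        rw [hG, invPhiHat, inv_pow, div_eq_mul_inv]
    _ = _ := by ring

theorem NuAssumptions.psi_le (H : NuAssumptions d ν a b β ℓ a₃ α₃) (hd : 0 < d) :
    ∃ c : ℝ, 0 < c ∧ ∀ ρ : ℝ, 0 < ρ → psi d hd ν ρ ≤ c * invPhiHat d ν ρ⁻¹ := by
  obtain ⟨c, hc, h⟩ := H.radial_integral_le hd
  set V := volume.real (Metric.ball (0 : EuclideanSpace ℝ (Fin d)) 1)
  have hVpos : 0 < V := volume_real_unitBall_pos d
  refine ⟨2 * (d * (V * c)), by positivity, fun ρ hρ => ?_⟩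
  have h' := h ρ⁻¹ (inv_pos.mpr hρ)
  rw [inv_inv] at h'
  calc psi d hd ν ρ
      ≤ ∫ z : EuclideanSpace ℝ (Fin d), 2 * (min 1 (ρ ^ 2 * ‖z‖ ^ 2) * ν ‖z‖) := by
        refine integral_mono (H.integrable_psi_integrand _ ρ)
          ((H.integrable_min_mul ρ).const_mul 2) fun z => ?_
        rcases eq_or_ne z 0 with rfl | hz
        · simp
        have := H.ν_pos _ (norm_pos_iff.mpr hz)
        calc _ ≤ 2 * min 1 (ρ ^ 2 * ‖z‖ ^ 2) * ν ‖z‖ := by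
              gcongr
              exact one_sub_cos_coord_le _ _ _
          _ = _ := by ring
    _ = 2 * (d * (V * ∫ s in Ioi (0 : ℝ), s ^ (d - 1) * (min 1 (ρ ^ 2 * s ^ 2) * ν s))) := by
        rw [integral_const_mul, integral_radial hd fun s => min 1 (ρ ^ 2 * s ^ 2) * ν s]
    _ ≤ 2 * (d * (V * (c * invPhiHat d ν ρ⁻¹))) := by gcongr
    _ = _ := by ring

theorem NuAssumptions.exists_psi_le_of_le (H : NuAssumptions d ν a b β ℓ a₃ α₃) (hd : 0 < d) :
    ∃ c : ℝ, 0 < c ∧ ∀ u s : ℝ, 0 < u → u ≤ s → psi d hd ν u ≤ c * invPhiHat d ν s⁻¹ := by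
  obtain ⟨c, hc, h⟩ := H.psi_le hd
  have ha₃ := H.a₃_pos
  refine ⟨c / a₃, by positivity, fun u s hu hus => (h u hu).trans ?_⟩
  have := H.invPhiHat_almost_antitone hd (inv_pos.mpr (hu.trans_le hus)) (inv_anti₀ hu hus)
  rw [div_mul_eq_mul_div, le_div_iff₀ ha₃]
  calc c * invPhiHat d ν u⁻¹ * a₃ = c * (a₃ * invPhiHat d ν u⁻¹) := by ring
    _ ≤ _ := by gcongr

theorem NuAssumptions.exists_le_psi_of_le (H : NuAssumptions d ν a b β ℓ a₃ α₃) (hd : 0 < d) :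
    ∃ c : ℝ, 0 < c ∧ ∀ s ρ : ℝ, 0 < s → s ≤ ρ →
      c * (ρ / s) ^ α₃ * invPhiHat d ν s⁻¹ ≤ psi d hd ν ρ := by
  obtain ⟨c, hc, h⟩ := H.psi_ge hd
  have ha₃ := H.a₃_pos
  refine ⟨c * a₃, by positivity, fun s ρ hs hsρ => le_trans ?_ (h ρ (hs.trans_le hsρ))⟩
  have := H.invPhiHat_scaling hd (inv_pos.mpr (hs.trans_le hsρ)) (inv_anti₀ hs hsρ)
  rw [inv_div_inv] at this
  calc c * a₃ * (ρ / s) ^ α₃ * invPhiHat d ν s⁻¹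
      = c * (a₃ * (ρ / s) ^ α₃ * invPhiHat d ν s⁻¹) := by ring
    _ ≤ _ := by gcongr

theorem NuAssumptions.nonempty_le_Psi (H : NuAssumptions d ν a b β ℓ a₃ α₃) (hd : 0 < d)
    (u : ℝ) : {s : ℝ | 0 < s ∧ u ≤ Psi d hd ν s}.Nonempty := by
  obtain ⟨c, hc, h⟩ := H.exists_le_psi_of_le hd
  obtain ⟨C, -, hC⟩ := H.exists_psi_le_of_le hd
  have hG := H.invPhiHat_pos hd (inv_pos.mpr one_pos)
  have ht : Tendsto (fun s : ℝ => c * invPhiHat d ν 1⁻¹ * s ^ α₃) atTop atTop :=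
    (tendsto_rpow_atTop H.α₃_pos).const_mul_atTop (by positivity)
  obtain ⟨s, hs, hs1⟩ := ((ht.eventually_ge_atTop u).and (eventually_ge_atTop 1)).exists
  have hs0 : 0 < s := by linarith
  refine ⟨s, hs0, hs.trans ?_⟩
  have h1 := h 1 s one_pos hs1
  rw [div_one] at h1
  refine le_trans (by linarith) (le_csSup ⟨C * invPhiHat d ν s⁻¹, ?_⟩ ⟨s, ⟨hs0, le_rfl⟩, rfl⟩)
  rintro _ ⟨x, hx, rfl⟩
  exact hC x s hx.1 hx.2

theorem integrable_exp_neg_rpow_mul_pow {n : ℕ} (hn : 0 < n) (m : ℕ) {κ α : ℝ} (hκ : 0 < κ)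
    (hα : 0 < α) :
    Integrable fun z : EuclideanSpace ℝ (Fin n) => Real.exp (-κ * ‖z‖ ^ α) * ‖z‖ ^ m := by
  rw [integrable_radial_iff hn fun s => Real.exp (-κ * s ^ α) * s ^ m]
  have h := integrableOn_rpow_mul_exp_neg_mul_rpow (s := ((n - 1 + m : ℕ) : ℝ))
    (by linarith [Nat.cast_nonneg (α := ℝ) (n - 1 + m)]) hα hκ
  refine h.congr_fun (fun s _ => ?_) measurableSet_Ioi
  simp only [Real.rpow_natCast]
  ring

theorem NuAssumptions.exists_rpow_le_mul_psi (H : NuAssumptions d ν a b β ℓ a₃ α₃) (hd : 0 < d) :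
    ∃ κ : ℝ, 0 < κ ∧ ∀ t x ρ : ℝ, 0 < t → 0 < x → t⁻¹ ≤ Psi d hd ν x → 0 ≤ ρ →
      κ * (ρ / x) ^ α₃ - κ ≤ t * psi d hd ν ρ := by
  obtain ⟨c, hc, h⟩ := H.exists_le_psi_of_le hd
  obtain ⟨C, hC0, hC⟩ := H.exists_psi_le_of_le hd
  refine ⟨c / C, by positivity, fun t x ρ ht hx hPsi hρ => ?_⟩
  have hψ := H.psi_nonneg hd ρ
  rcases le_total ρ x with hρx | hxρ
  · have h1 : (ρ / x) ^ α₃ ≤ 1 :=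
      Real.rpow_le_one (by positivity) (div_le_one_of_le₀ hρx hx.le) H.α₃_pos.le
    have h2 : c / C * (ρ / x) ^ α₃ ≤ c / C * 1 := by gcongr
    have h3 : 0 ≤ t * psi d hd ν ρ := by positivity
    linarith
  · have hG : t⁻¹ ≤ C * invPhiHat d ν x⁻¹ := by
      refine hPsi.trans (csSup_le ⟨_, x, ⟨hx, le_rfl⟩, rfl⟩ ?_)
      rintro _ ⟨u, hu, rfl⟩
      exact hC u x hu.1 hu.2
    have h1 := h x ρ hx hxρ
    have h2 : 1 ≤ t * (C * invPhiHat d ν x⁻¹) := by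
      rwa [inv_le_iff_one_le_mul₀' ht] at hG
    have h3 : 0 ≤ (ρ / x) ^ α₃ := by positivity
    calc c / C * (ρ / x) ^ α₃ - c / C ≤ c / C * (ρ / x) ^ α₃ * 1 := by
          have : 0 < c / C := by positivity
          linarith
      _ ≤ c / C * (ρ / x) ^ α₃ * (t * (C * invPhiHat d ν x⁻¹)) := by gcongr
      _ = t * (c * (ρ / x) ^ α₃ * invPhiHat d ν x⁻¹) := by field_simp
      _ ≤ _ := by gcongr

end

/-- exponential moment bound for the characteristic exponent. -/
theorem exp_psi_moment_bound (d : ℕ) (hd : 0 < d) (ν : ℝ → ℝ) (a b β ℓ a₃ α₃ : ℝ)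
    (H : NuAssumptions d ν a b β ℓ a₃ α₃) :
    ∀ n m : ℕ, 1 ≤ n → 1 ≤ m → ∃ c : ℝ, 0 < c ∧ ∀ t : ℝ, 0 < t →
      (∫ z : EuclideanSpace ℝ (Fin n),
          Real.exp (-t * psi d hd ν ‖z‖) * ‖z‖ ^ m)
        ≤ c * PsiInv d hd ν t⁻¹ ^ (n + m) := by
  intro n m hn _
  obtain ⟨κ, hκ, hψ⟩ := H.exists_rpow_le_mul_psi hd
  let f : EuclideanSpace ℝ (Fin n) → ℝ := fun z => Real.exp (-κ * ‖z‖ ^ α₃) * ‖z‖ ^ m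
  have hf : Integrable f := integrable_exp_neg_rpow_mul_pow hn m hκ H.α₃_pos
  have hA : 0 ≤ ∫ z, f z := integral_nonneg fun z => by positivity
  refine ⟨Real.exp κ * (∫ z, f z) + 1, by positivity, fun t ht => ?_⟩
  have key : ∀ x ∈ {s : ℝ | 0 < s ∧ t⁻¹ ≤ Psi d hd ν s},
      (∫ z : EuclideanSpace ℝ (Fin n), Real.exp (-t * psi d hd ν ‖z‖) * ‖z‖ ^ m) ≤
        (Real.exp κ * (∫ z, f z) + 1) * x ^ (n + m) := by
    rintro x ⟨hx, hPsi⟩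
    calc (∫ z : EuclideanSpace ℝ (Fin n), Real.exp (-t * psi d hd ν ‖z‖) * ‖z‖ ^ m)
        ≤ ∫ z : EuclideanSpace ℝ (Fin n), Real.exp κ * x ^ m * f (x⁻¹ • z) := by
          refine integral_mono_of_nonneg (Eventually.of_forall fun z => by positivity)
            ((hf.comp_smul (inv_ne_zero hx.ne')).const_mul _) (Eventually.of_forall fun z => ?_)
          have h := hψ t x ‖z‖ ht hx hPsi (norm_nonneg z)
          have hnorm : ‖x⁻¹ • z‖ = ‖z‖ / x := by
            rw [norm_smul, norm_inv, Real.norm_of_nonneg hx.le, inv_mul_eq_div]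
          calc Real.exp (-t * psi d hd ν ‖z‖) * ‖z‖ ^ m
              ≤ Real.exp (κ + -κ * (‖z‖ / x) ^ α₃) * ‖z‖ ^ m := by
                gcongr
                linarith
            _ = Real.exp κ * x ^ m * f (x⁻¹ • z) := by
                simp only [f, hnorm, Real.exp_add, div_pow]
                field_simp
      _ = Real.exp κ * (∫ z, f z) * x ^ (n + m) := by
          rw [integral_const_mul, Measure.integral_comp_inv_smul_of_nonneg _ _ hx.le,
            finrank_euclideanSpace_fin, smul_eq_mul]
          ring
      _ ≤ _ := by
          gcongr
          linarith
  obtain ⟨u, -, hu, hmem⟩ := exists_seq_tendsto_sInf (H.nonempty_le_Psi hd t⁻¹)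
    ⟨0, fun s hs => hs.1.le⟩
  exact ge_of_tendsto' ((hu.pow (n + m)).const_mul _) fun k => key (u k) (hmem k)
end

section
/- Assume ν satisfies (N1) and (N2). Then ∫_{ℝ^d} ν(|x|) dx = ∞ and ∫_{ℝ^{d+2}} ν₁(|x|) dx = ∞, and there exists a constant c > 0 such that: (1) for every bounded Borel set A ⊆ ℝ^d with δ(A) := inf{|y| : y ∈ A} > 0, ∫_A ν(|x|) dx ≤ c · f̃(δ(A)) · diam(A)^d; and (2) for every bounded Borel set A ⊆ ℝ^{d+2} with δ(A) > 0, ∫_A ν₁(|x|) dx ≤ c · f(δ(A)) · diam(A)^{d+1}, where diam(A) = sup{|x−y| : x,y ∈ A}. -/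
open MeasureTheory Filter Set

attribute [local instance] Classical.propDecidable

open Metric Module
open scoped Pointwise

/-- A truncated cone over a subset of the unit sphere of diameter at most `ε` in dimension `n + 1`
has volume at most of order `ε ^ n`. -/
theorem measure_Ioo_smul_le {E : Type*} [NormedAddCommGroup E] [NormedSpace ℝ E]
    [FiniteDimensional ℝ E] [MeasurableSpace E] [BorelSpace E] (μ : Measure E)
    [μ.IsAddHaarMeasure] {n : ℕ} (hn : finrank ℝ E = n + 1) {S : Set E}
    (hS : S ⊆ sphere 0 1) {ε : ℝ} (hε : 0 < ε) (hSε : ∀ x ∈ S, ∀ y ∈ S, dist x y ≤ ε) :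
    μ (Ioo (0 : ℝ) 1 • S) ≤ ENNReal.ofReal (2 ^ (n + 2) * ε ^ n) * μ (closedBall 0 1) := by
  rcases S.eq_empty_or_nonempty with rfl | ⟨x₀, hx₀⟩
  · simp
  have hnorm : ∀ x ∈ S, ‖x‖ = 1 := fun x hx => by simpa using hS hx
  rcases le_or_gt 1 ε with h1 | h1
  · calc μ (Ioo (0 : ℝ) 1 • S) ≤ 1 * μ (closedBall 0 1) := by
          rw [one_mul]
          apply measure_mono
          rintro _ ⟨t, ht, x, hx, rfl⟩
          simp only [mem_closedBall, dist_zero_right, norm_smul, hnorm x hx, mul_one,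
            Real.norm_eq_abs, abs_of_pos ht.1]
          exact ht.2.le
      _ ≤ _ := by
          gcongr
          rw [← ENNReal.ofReal_one]
          apply ENNReal.ofReal_le_ofReal
          have h2 : (1 : ℝ) ≤ 2 ^ (n + 2) := one_le_pow₀ (by norm_num)
          have h3 : (1 : ℝ) ≤ ε ^ n := one_le_pow₀ h1
          nlinarith
  · have hsub : Ioo (0 : ℝ) 1 • S ⊆
        ⋃ k ∈ Finset.range ⌈1 / ε⌉₊, closedBall (((k : ℝ) * ε) • x₀) (2 * ε) := by
      rintro _ ⟨t, ht, x, hx, rfl⟩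
      have hle : (⌊t / ε⌋₊ : ℝ) * ε ≤ t := by
        rw [← le_div_iff₀ hε]
        exact Nat.floor_le (div_nonneg ht.1.le hε.le)
      have hlt : t < ((⌊t / ε⌋₊ : ℝ) + 1) * ε := by
        rw [← div_lt_iff₀ hε]
        exact Nat.lt_floor_add_one _
      simp only [mem_iUnion, Finset.mem_range, exists_prop]
      refine ⟨⌊t / ε⌋₊, ?_, ?_⟩
      · rw [Nat.lt_ceil, lt_div_iff₀ hε]
        linarith [ht.2]
      · rw [mem_closedBall, dist_eq_norm]
        have hdec : t • x - ((⌊t / ε⌋₊ : ℝ) * ε) • x₀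
            = t • (x - x₀) + (t - (⌊t / ε⌋₊ : ℝ) * ε) • x₀ := by
          module
        have hxx := hSε x hx x₀ hx₀
        rw [dist_eq_norm] at hxx
        calc ‖t • x - ((⌊t / ε⌋₊ : ℝ) * ε) • x₀‖
            ≤ ‖t • (x - x₀)‖ + ‖(t - (⌊t / ε⌋₊ : ℝ) * ε) • x₀‖ := by
              rw [hdec]
              exact norm_add_le _ _
          _ = t * ‖x - x₀‖ + (t - (⌊t / ε⌋₊ : ℝ) * ε) := by
              rw [norm_smul, norm_smul, hnorm x₀ hx₀, Real.norm_eq_abs, Real.norm_eq_abs,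
                abs_of_pos ht.1, abs_of_nonneg (by linarith), mul_one]
          _ ≤ 2 * ε := by
              have := mul_le_mul ht.2.le hxx (norm_nonneg _) zero_le_one
              linarith
    calc μ (Ioo (0 : ℝ) 1 • S)
        ≤ ∑ k ∈ Finset.range ⌈1 / ε⌉₊, μ (closedBall (((k : ℝ) * ε) • x₀) (2 * ε)) :=
          (measure_mono hsub).trans (measure_biUnion_finset_le _ _)
      _ = ENNReal.ofReal (⌈1 / ε⌉₊ * (2 * ε) ^ (n + 1)) * μ (closedBall 0 1) := by
          simp only [μ.addHaar_closedBall' _ (by positivity : (0 : ℝ) ≤ 2 * ε), hn,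
            Finset.sum_const, Finset.card_range, nsmul_eq_mul]
          rw [ENNReal.ofReal_mul (by positivity), ENNReal.ofReal_natCast, mul_assoc]
      _ ≤ _ := by
          gcongr ENNReal.ofReal ?_ * _
          have hN : (⌈1 / ε⌉₊ : ℝ) * ε ≤ 2 := by
            have := (Nat.ceil_lt_add_one (by positivity : 0 ≤ 1 / ε)).le
            calc (⌈1 / ε⌉₊ : ℝ) * ε ≤ (1 / ε + 1) * ε := by gcongr
              _ = 1 + ε := by field_simp
              _ ≤ 2 := by linarith
          calc (⌈1 / ε⌉₊ : ℝ) * (2 * ε) ^ (n + 1)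
              = (⌈1 / ε⌉₊ * ε) * (2 ^ (n + 1) * ε ^ n) := by ring
            _ ≤ 2 * (2 ^ (n + 1) * ε ^ n) := by gcongr
            _ = 2 ^ (n + 2) * ε ^ n := by ring

/-- The integral of a radial function over a set of diameter at most `D` in dimension `n + 1`
is at most of order `D ^ n` times the one-dimensional integral of the profile. -/
theorem setLIntegral_fun_norm_le {E : Type*} [NormedAddCommGroup E] [NormedSpace ℝ E]
    [FiniteDimensional ℝ E] [MeasurableSpace E] [BorelSpace E] (μ : Measure E)
    [μ.IsAddHaarMeasure] {n : ℕ} (hn : finrank ℝ E = n + 1) {A : Set E} (hA : MeasurableSet A)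
    {g : ℝ → ENNReal} (hg : Measurable g) {δ R D : ℝ} (hD : 0 < D)
    (hAnorm : ∀ x ∈ A, ‖x‖ ∈ Icc δ R) (hAD : ∀ x ∈ A, ∀ y ∈ A, dist x y ≤ D) :
    ∫⁻ x in A, g ‖x‖ ∂μ ≤
      (n + 1) * ENNReal.ofReal (2 ^ (n + 2) * D ^ n) * μ (closedBall 0 1) *
        ∫⁻ r in Icc δ R, g r := by
  have : Nontrivial E := finrank_pos_iff (R := ℝ).1 (by omega)
  set C : ENNReal := (n + 1) * ENNReal.ofReal (2 ^ (n + 2) * D ^ n) * μ (closedBall 0 1) with hC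
  have hpolar : ∀ F : E → ENNReal, Measurable F → ∫⁻ x, F x ∂μ =
      ∫⁻ r : Ioi (0 : ℝ), ENNReal.ofReal (r.1 ^ n) * ∫⁻ θ : sphere (0 : E) 1,
        F (r.1 • θ.1) ∂μ.toSphere ∂(volume.comap Subtype.val) := by
    intro F hF
    have hcont : Measurable fun p : sphere (0 : E) 1 × Ioi (0 : ℝ) => F (p.2.1 • p.1.1) :=
      hF.comp (by fun_prop)
    rw [← restrict_compl_singleton (μ := μ) 0,
      ← lintegral_subtype_comap (measurableSet_singleton _).compl]
    have h := μ.measurePreserving_homeomorphUnitSphereProd.lintegral_comp hcont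
    simp only [hn, Nat.add_sub_cancel] at h
    rw [lintegral_prod_symm _ hcont.aemeasurable, Measure.volumeIoiPow,
      lintegral_withDensity_eq_lintegral_mul _ (by fun_prop) hcont.lintegral_prod_left'] at h
    simp only [Pi.mul_apply] at h
    rw [restrict_compl_singleton, ← h]
    refine lintegral_congr fun x => ?_
    congr 1
    have := congrArg Subtype.val ((homeomorphUnitSphereProd E).symm_apply_apply x)
    rw [homeomorphUnitSphereProd_symm_apply_coe] at this
    exact this.symm
  have hgn : Measurable fun x : E => g ‖x‖ := hg.comp measurable_norm
  rw [← lintegral_indicator hA, hpolar _ (hgn.indicator hA)]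
  have hslice : ∀ r : Ioi (0 : ℝ), ENNReal.ofReal (r.1 ^ n) * ∫⁻ θ : sphere (0 : E) 1,
      A.indicator (fun x => g ‖x‖) (r.1 • θ.1) ∂μ.toSphere
        ≤ C * (Icc δ R).indicator g r.1 := by
    rintro ⟨r, hr : 0 < r⟩
    set T : Set (sphere (0 : E) 1) := {θ | r • θ.1 ∈ A}
    have hTm : MeasurableSet T := hA.preimage (by fun_prop)
    have heq : ∀ θ : sphere (0 : E) 1, A.indicator (fun x => g ‖x‖) (r • θ.1)
        = T.indicator (fun _ => (Icc δ R).indicator g r) θ := by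
      intro θ
      by_cases h : r • θ.1 ∈ A
      · have hθ : ‖r • θ.1‖ = r := by simp [norm_smul, abs_of_pos hr]
        have hm := hAnorm _ h
        rw [hθ] at hm
        rw [indicator_of_mem h, indicator_of_mem (show θ ∈ T from h), indicator_of_mem hm, hθ]
      · rw [indicator_of_notMem h, indicator_of_notMem (show θ ∉ T from h)]
    have hcone := measure_Ioo_smul_le μ hn (S := Subtype.val '' T) (ε := D / r)
      (by rintro _ ⟨θ, -, rfl⟩; exact θ.2) (by positivity)
      (by
        rintro _ ⟨θ, hθ, rfl⟩ _ ⟨θ', hθ', rfl⟩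
        have := hAD _ hθ _ hθ'
        rw [dist_smul₀, Real.norm_eq_abs, abs_of_pos hr] at this
        rw [le_div_iff₀ hr]
        linarith)
    simp only [heq]
    rw [lintegral_indicator_const hTm, μ.toSphere_apply' hTm, hn]
    calc ENNReal.ofReal (r ^ n) * ((Icc δ R).indicator g r *
          (((n + 1 : ℕ) : ENNReal) * μ (Ioo (0 : ℝ) 1 • (Subtype.val '' T))))
        ≤ ENNReal.ofReal (r ^ n) * ((Icc δ R).indicator g r *
          (((n + 1 : ℕ) : ENNReal) *
            (ENNReal.ofReal (2 ^ (n + 2) * (D / r) ^ n) * μ (closedBall 0 1)))) := by gcongr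
      _ = ((n + 1 : ℕ) : ENNReal) * (ENNReal.ofReal (r ^ n) *
          ENNReal.ofReal (2 ^ (n + 2) * (D / r) ^ n)) * μ (closedBall 0 1) *
            (Icc δ R).indicator g r := by ring
      _ = C * (Icc δ R).indicator g r := by
          rw [← ENNReal.ofReal_mul (by positivity), hC]
          congr 4
          · push_cast; rfl
          · rw [div_pow]; field_simp
  calc _ ≤ ∫⁻ r : Ioi (0 : ℝ), C * (Icc δ R).indicator g r.1 ∂(volume.comap Subtype.val) :=
        lintegral_mono hslice
    _ = ∫⁻ r in Ioi (0 : ℝ), C * (Icc δ R).indicator g r :=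
        lintegral_subtype_comap measurableSet_Ioi fun r => C * (Icc δ R).indicator g r
    _ ≤ ∫⁻ r, C * (Icc δ R).indicator g r := setLIntegral_le_lintegral _ _
    _ = _ := by
        rw [lintegral_const_mul _ (hg.indicator measurableSet_Icc),
          lintegral_indicator measurableSet_Icc]

namespace NuAssumptions

variable {d : ℕ} {ν : ℝ → ℝ} {a b β ℓ a₃ α₃ : ℝ}

theorem setIntegral_pos (H : NuAssumptions d ν a b β ℓ a₃ α₃) {r : ℝ} (hr : 0 < r)
    (hr1 : r ≤ 1) : 0 < ∫ s in Ioo (0 : ℝ) r, s ^ (d + 1) * ν s := by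
  refine lt_of_le_of_ne (setIntegral_nonneg measurableSet_Ioo fun s hs =>
    mul_nonneg (pow_nonneg hs.1.le _) (H.ν_pos s hs.1).le) fun h0 => ?_
  have h := H.hN2 r r hr le_rfl
  rw [div_self hr.ne', Real.one_rpow, mul_one, phiHat, if_pos hr1, ← h0] at h
  simp only [div_zero] at h
  exact absurd H.a₃_pos (not_lt.2 h)

theorem integrableOn (H : NuAssumptions d ν a b β ℓ a₃ α₃) {r : ℝ} (hr : 0 < r)
    (hr1 : r ≤ 1) : IntegrableOn (fun s => s ^ (d + 1) * ν s) (Ioo 0 r) :=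
  not_imp_comm.1 integral_undef (H.setIntegral_pos hr hr1).ne'

theorem phiHat_one_div (H : NuAssumptions d ν a b β ℓ a₃ α₃) {r : ℝ} (hr : 0 < r)
    (hr1 : r ≤ 1) : phiHat d ν 1 / phiHat d ν r =
      (∫ s in Ioo (0 : ℝ) r, s ^ (d + 1) * ν s) /
        ((∫ s in Ioo (0 : ℝ) 1, s ^ (d + 1) * ν s) * r ^ 2) := by
  have h1 := H.setIntegral_pos one_pos le_rfl
  have h2 := H.setIntegral_pos hr hr1
  rw [phiHat, phiHat, if_pos le_rfl, if_pos hr1]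
  field_simp

theorem not_integrableOn_pow_mul (H : NuAssumptions d ν a b β ℓ a₃ α₃) (hd : 0 < d) :
    ¬ IntegrableOn (fun s => s ^ (d - 1) * ν s) (Ioo 0 1) := by
  intro hint
  have h1 := H.setIntegral_pos one_pos le_rfl
  set I₁ := ∫ s in Ioo (0 : ℝ) 1, s ^ (d + 1) * ν s
  set M := ∫ s in Ioo (0 : ℝ) 1, s ^ (d - 1) * ν s
  have hbound : ∀ r : ℝ, 0 < r → r ≤ 1 → a₃ * (1 / r) ^ α₃ ≤ M / I₁ := by
    intro r hr hr1
    have hsub : Ioo (0 : ℝ) r ⊆ Ioo 0 1 := Ioo_subset_Ioo_right hr1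
    have hle : ∫ s in Ioo (0 : ℝ) r, s ^ (d + 1) * ν s ≤ r ^ 2 * M := by
      calc ∫ s in Ioo (0 : ℝ) r, s ^ (d + 1) * ν s
          ≤ ∫ s in Ioo (0 : ℝ) r, r ^ 2 * (s ^ (d - 1) * ν s) := by
            refine setIntegral_mono_on (H.integrableOn hr hr1)
              ((hint.mono_set hsub).const_mul _) measurableSet_Ioo fun s hs => ?_
            have hpow : s ^ (d + 1) = s ^ 2 * s ^ (d - 1) := by
              rw [← pow_add]
              congr 1
              omega
            rw [hpow, mul_assoc]
            have h2 : s ^ 2 ≤ r ^ 2 := pow_le_pow_left₀ hs.1.le hs.2.le 2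
            exact mul_le_mul_of_nonneg_right h2
              (mul_nonneg (pow_nonneg hs.1.le _) (H.ν_pos s hs.1).le)
        _ = r ^ 2 * ∫ s in Ioo (0 : ℝ) r, s ^ (d - 1) * ν s := integral_const_mul _ _
        _ ≤ r ^ 2 * M := by
            refine mul_le_mul_of_nonneg_left (setIntegral_mono_set hint ?_ hsub.eventuallyLE)
              (by positivity)
            filter_upwards [ae_restrict_mem measurableSet_Ioo] with s hs
            exact mul_nonneg (pow_nonneg hs.1.le _) (H.ν_pos s hs.1).le
    refine (H.hN2 r 1 hr hr1).trans ?_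
    rw [H.phiHat_one_div hr hr1, div_le_div_iff₀ (by positivity) h1]
    nlinarith
  have htend : Tendsto (fun x : ℝ => a₃ * x ^ α₃) atTop atTop :=
    (tendsto_rpow_atTop H.α₃_pos).const_mul_atTop H.a₃_pos
  obtain ⟨x, hx, hx1⟩ := ((htend.eventually_gt_atTop (M / I₁)).and (eventually_ge_atTop 1)).exists
  have hx0 : 0 < x := one_pos.trans_le hx1
  have := hbound (1 / x) (by positivity) ((div_le_one hx0).2 hx1)
  rw [one_div_one_div] at this
  linarith

theorem deriv_nonpos (H : NuAssumptions d ν a b β ℓ a₃ α₃) {r : ℝ} (hr : 0 < r) :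
    deriv ν r ≤ 0 := by
  have h := H.ν_anti.derivWithin_nonpos (x := r)
  rwa [derivWithin_of_mem_nhds (Ioi_mem_nhds hr)] at h

theorem nu1_nonneg (H : NuAssumptions d ν a b β ℓ a₃ α₃) {r : ℝ} (hr : 0 < r) :
    0 ≤ nu1 ν r :=
  div_nonneg (neg_nonneg.2 (H.deriv_nonpos hr)) (by positivity)

theorem intervalIntegrable_deriv (H : NuAssumptions d ν a b β ℓ a₃ α₃) {s t : ℝ} (hs : 0 < s)
    (hst : s ≤ t) : IntervalIntegrable (deriv ν) volume s t := by
  have hpos : ∀ x ∈ Icc s t, 0 < x := fun x hx => hs.trans_le hx.1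
  have h : IntervalIntegrable (fun x => -deriv ν x) volume s t := by
    rw [intervalIntegrable_iff_integrableOn_Ioc_of_le hst]
    refine intervalIntegral.integrableOn_deriv_of_nonneg (g := fun x => -ν x)
      (fun x hx => (H.ν_diff x (hpos x hx)).continuousAt.neg.continuousWithinAt)
      (fun x hx => (H.ν_diff x (hpos x (Ioo_subset_Icc_self hx))).hasDerivAt.neg)
      fun x hx => neg_nonneg.2 (H.deriv_nonpos (hpos x (Ioo_subset_Icc_self hx)))
  exact h.neg.congr fun x _ => neg_neg _

theorem setLIntegral_neg_deriv_le (H : NuAssumptions d ν a b β ℓ a₃ α₃) {s t : ℝ} (hs : 0 < s)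
    (hst : s ≤ t) : ∫⁻ r in Icc s t, ENNReal.ofReal (-deriv ν r) ≤ ENNReal.ofReal (ν s) := by
  have hint := H.intervalIntegrable_deriv hs hst
  have hpos : ∀ x ∈ Icc s t, 0 < x := fun x hx => hs.trans_le hx.1
  rw [Measure.restrict_congr_set Ioc_ae_eq_Icc.symm, ← ofReal_integral_eq_lintegral_ofReal
    (f := fun r => -deriv ν r) hint.neg.1]
  · apply ENNReal.ofReal_le_ofReal
    rw [integral_neg, ← intervalIntegral.integral_of_le hst,
      intervalIntegral.integral_eq_sub_of_hasDerivAt (f := ν) (fun x hx => ?_) hint]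
    · linarith [H.ν_pos t (hs.trans_le hst)]
    · rw [uIcc_of_le hst] at hx
      exact (H.ν_diff x (hpos x hx)).hasDerivAt
  · filter_upwards [ae_restrict_mem measurableSet_Ioc] with x hx
    exact neg_nonneg.2 (H.deriv_nonpos (hpos x (Ioc_subset_Icc_self hx)))

theorem not_integrableOn_pow_mul_deriv (H : NuAssumptions d ν a b β ℓ a₃ α₃) (hd : 0 < d) :
    ¬ IntegrableOn (fun s => s ^ d * deriv ν s) (Ioc 0 1) := by
  intro hint
  refine H.not_integrableOn_pow_mul hd (IntegrableOn.mono_set ?_ Ioo_subset_Ioc_self)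
  have hcont : ∀ s, 0 < s → ContinuousOn (fun r => r ^ (d - 1) * ν r) (Icc s 1) :=
    fun s hs x hx => ((continuousAt_id.pow _).mul
      (H.ν_diff x (hs.trans_le hx.1)).continuousAt).continuousWithinAt
  have hsmall : ∀ i : ℕ, 0 < 1 / ((i : ℝ) + 1) ∧ 1 / ((i : ℝ) + 1) ≤ 1 := fun i =>
    ⟨by positivity, by rw [div_le_one (by positivity)]; linarith [i.cast_nonneg (α := ℝ)]⟩
  refine integrableOn_Ioc_of_intervalIntegral_norm_bounded_left (l := atTop)
    (a := fun i : ℕ => 1 / ((i : ℝ) + 1)) (I := ν 1 + ∫ s in Ioc (0 : ℝ) 1, ‖s ^ d * deriv ν s‖)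
    (fun i => ((hcont _ (hsmall i).1).integrableOn_Icc).mono_set Ioc_subset_Icc_self)
    tendsto_one_div_add_atTop_nhds_zero_nat (Eventually.of_forall fun i => ?_)
  obtain ⟨hs0, hs1⟩ := hsmall i
  set s : ℝ := 1 / ((i : ℝ) + 1)
  have hsub : Ioc s 1 ⊆ Ioc 0 1 := Ioc_subset_Ioc_left hs0.le
  have hi1 : IntervalIntegrable (fun r => r ^ (d - 1) * ν r) volume s 1 :=
    ContinuousOn.intervalIntegrable (by rw [uIcc_of_le hs1]; exact hcont s hs0)
  have hi2 : IntervalIntegrable (fun r => r ^ d * deriv ν r) volume s 1 :=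
    (intervalIntegrable_iff_integrableOn_Ioc_of_le hs1).2 (hint.mono_set hsub)
  have hparts : ∫ r in s..1, (d * (r ^ (d - 1) * ν r) + r ^ d * deriv ν r)
      = 1 ^ d * ν 1 - s ^ d * ν s := by
    refine intervalIntegral.integral_eq_sub_of_hasDerivAt (f := fun r => r ^ d * ν r)
      (fun x hx => ?_) ((hi1.const_mul _).add hi2)
    rw [uIcc_of_le hs1] at hx
    rw [← mul_assoc]
    exact (hasDerivAt_pow d x).mul (H.ν_diff x (hs0.trans_le hx.1)).hasDerivAt
  rw [intervalIntegral.integral_add (hi1.const_mul _) hi2,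
    intervalIntegral.integral_const_mul] at hparts
  have hnn : ∀ r ∈ Ioc s 1, 0 ≤ r ^ (d - 1) * ν r := fun r hr =>
    mul_nonneg (pow_nonneg (hs0.trans hr.1).le _) (H.ν_pos r (hs0.trans hr.1)).le
  have hJ : ∫ r in Ioc s 1, ‖r ^ (d - 1) * ν r‖ = ∫ r in s..1, r ^ (d - 1) * ν r := by
    rw [intervalIntegral.integral_of_le hs1]
    exact setIntegral_congr_fun measurableSet_Ioc fun r hr => Real.norm_of_nonneg (hnn r hr)
  have hJ0 : 0 ≤ ∫ r in s..1, r ^ (d - 1) * ν r := by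
    rw [intervalIntegral.integral_of_le hs1]
    exact setIntegral_nonneg measurableSet_Ioc hnn
  have hK : -∫ r in s..1, r ^ d * deriv ν r ≤ ∫ r in Ioc (0 : ℝ) 1, ‖r ^ d * deriv ν r‖ := by
    calc -∫ r in s..1, r ^ d * deriv ν r ≤ ‖∫ r in s..1, r ^ d * deriv ν r‖ := neg_le_abs _
      _ ≤ ∫ r in Ioc s 1, ‖r ^ d * deriv ν r‖ := by
          rw [intervalIntegral.integral_of_le hs1]
          exact norm_integral_le_integral_norm _
      _ ≤ _ := setIntegral_mono_set hint.norm (Eventually.of_forall fun _ => norm_nonneg _)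
          hsub.eventuallyLE
  have hd1 : (1 : ℝ) ≤ d := by exact_mod_cast hd
  have hG : 0 ≤ s ^ d * ν s := mul_nonneg (by positivity) (H.ν_pos s hs0).le
  have hdJ := mul_le_mul_of_nonneg_right hd1 hJ0
  rw [one_pow, one_mul] at hparts
  rw [one_mul] at hdJ
  rw [hJ]
  linarith

theorem lintegral_nu_eq_top (H : NuAssumptions d ν a b β ℓ a₃ α₃) (hd : 0 < d) :
    ∫⁻ y : EuclideanSpace ℝ (Fin d), ENNReal.ofReal (ν ‖y‖) = ⊤ := by
  have : Nontrivial (EuclideanSpace ℝ (Fin d)) :=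
    finrank_pos_iff (R := ℝ).1 (by rw [finrank_euclideanSpace_fin]; exact hd)
  by_contra htop
  have hne : ∀ᵐ y : EuclideanSpace ℝ (Fin d), y ≠ 0 := by
    rw [ae_iff]
    simp
  have hmeas : AEStronglyMeasurable (fun y : EuclideanSpace ℝ (Fin d) => ν ‖y‖) := by
    have hinv : Measurable fun y : EuclideanSpace ℝ (Fin d) => (min 1 (‖y‖ ^ 2))⁻¹ := by fun_prop
    refine (hinv.aestronglyMeasurable.mul H.ν_int.1).congr ?_
    filter_upwards [hne] with y hy
    have : 0 < min 1 (‖y‖ ^ 2) := lt_min one_pos (by positivity)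
    simp only [Pi.mul_apply]
    field_simp
  have hint : Integrable fun y : EuclideanSpace ℝ (Fin d) => ν ‖y‖ := by
    rw [← lintegral_ofReal_ne_top_iff_integrable hmeas]
    · exact htop
    · filter_upwards [hne] with y hy
      exact (H.ν_pos _ (norm_pos_iff.2 hy)).le
  rw [integrable_fun_norm_addHaar, finrank_euclideanSpace_fin] at hint
  exact H.not_integrableOn_pow_mul hd (hint.mono_set fun x hx => hx.1)

theorem measurable_nu1 (ν : ℝ → ℝ) : Measurable (nu1 ν) :=
  (measurable_deriv ν).neg.div (by fun_prop)

theorem lintegral_nu1_eq_top (H : NuAssumptions d ν a b β ℓ a₃ α₃) (hd : 0 < d) :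
    ∫⁻ y : EuclideanSpace ℝ (Fin (d + 2)), ENNReal.ofReal (nu1 ν ‖y‖) = ⊤ := by
  by_contra htop
  have hne : ∀ᵐ y : EuclideanSpace ℝ (Fin (d + 2)), y ≠ 0 := by
    rw [ae_iff]
    simp
  have hint : Integrable fun y : EuclideanSpace ℝ (Fin (d + 2)) => nu1 ν ‖y‖ := by
    refine (lintegral_ofReal_ne_top_iff_integrable
      ((measurable_nu1 ν).comp measurable_norm).aestronglyMeasurable ?_).1 htop
    filter_upwards [hne] with y hy
    exact H.nu1_nonneg (norm_pos_iff.2 hy)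
  rw [integrable_fun_norm_addHaar, finrank_euclideanSpace_fin] at hint
  have hscaled : IntegrableOn (fun y => -(2 * Real.pi) * (y ^ (d + 2 - 1) • nu1 ν y)) (Ioc 0 1) :=
    Integrable.const_mul (hint.mono_set Ioc_subset_Ioi_self) _
  refine H.not_integrableOn_pow_mul_deriv hd
    (hscaled.congr_fun (fun x hx => ?_) measurableSet_Ioc)
  have hx0 : x ≠ 0 := hx.1.ne'
  have hpi := Real.pi_ne_zero
  simp only [nu1, smul_eq_mul, show d + 2 - 1 = d + 1 by omega, pow_succ]
  field_simp

theorem ftil_nonneg (H : NuAssumptions d ν a b β ℓ a₃ α₃) {r : ℝ} (hr : 0 < r) :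
    0 ≤ ftil d ν b β ℓ r := by
  rw [ftil]
  split_ifs with hr1
  · rw [mul_comm, ← div_div, H.phiHat_one_div hr hr1]
    have h1 := H.setIntegral_pos one_pos le_rfl
    have h2 := H.setIntegral_pos hr hr1
    positivity
  · positivity

theorem ffun_eq_ftil_div (ν : ℝ → ℝ) (b β ℓ : ℝ) {r : ℝ} (hr : 0 < r) :
    ffun d ν b β ℓ r = ftil d ν b β ℓ r / r := by
  rw [ffun, ftil]
  split_ifs with hr1
  · rw [div_div]
    ring
  · rw [Real.rpow_sub hr, Real.rpow_one]
    ring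

/-- The profile `ν` is dominated by a multiple of `f̃`. -/
theorem nu_le_mul_ftil (H : NuAssumptions d ν a b β ℓ a₃ α₃) {r : ℝ} (hr : 0 < r) :
    ν r ≤ (a + (d + 2) * ∫ s in Ioo (0 : ℝ) 1, s ^ (d + 1) * ν s) * ftil d ν b β ℓ r := by
  have h1 := H.setIntegral_pos one_pos le_rfl
  have hf := H.ftil_nonneg hr
  have ha := H.ha
  rw [add_mul]
  rcases le_or_gt r 1 with hr1 | hr1
  · refine le_add_of_nonneg_of_le (by positivity) ?_
    have hlow : r ^ (d + 2) / (d + 2) * ν r ≤ ∫ s in Ioo (0 : ℝ) r, s ^ (d + 1) * ν s := by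
      calc r ^ (d + 2) / (d + 2) * ν r = ∫ s in Ioo (0 : ℝ) r, s ^ (d + 1) * ν r := by
            rw [integral_mul_const, ← integral_Ioc_eq_integral_Ioo,
              ← intervalIntegral.integral_of_le hr.le, integral_pow]
            simp only [ne_eq, Nat.add_eq_zero_iff, one_ne_zero, and_false, not_false_eq_true,
              zero_pow, sub_zero, Nat.cast_add, Nat.cast_one]
            ring_nf
        _ ≤ _ := by
            refine setIntegral_mono_on ?_ (H.integrableOn hr hr1) measurableSet_Ioo fun s hs => ?_
            · exact (Continuous.integrableOn_Icc (by fun_prop)).mono_set Ioo_subset_Icc_self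
            · exact mul_le_mul_of_nonneg_left (H.ν_anti hs.1 hr hs.2.le) (pow_nonneg hs.1.le _)
    rw [ftil, if_pos hr1, mul_comm (r ^ d), ← div_div, H.phiHat_one_div hr hr1]
    set I₁ := ∫ s in Ioo (0 : ℝ) 1, s ^ (d + 1) * ν s
    set I := ∫ s in Ioo (0 : ℝ) r, s ^ (d + 1) * ν s
    have heq : (d + 2) * I₁ * (I / (I₁ * r ^ 2) / r ^ d) = (d + 2) * I / r ^ (d + 2) := by
      rw [pow_add]
      field_simp
    rw [heq, le_div_iff₀ (by positivity)]
    have hd2 : (0 : ℝ) < d + 2 := by positivity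
    rw [div_mul_eq_mul_div, div_le_iff₀ hd2] at hlow
    linarith
  · refine le_add_of_le_of_nonneg ?_ (by positivity)
    rw [ftil, if_neg (not_le.2 hr1), ← mul_assoc]
    exact H.hN1 r hr1

theorem setIntegral_nu_le (H : NuAssumptions d ν a b β ℓ a₃ α₃)
    {A : Set (EuclideanSpace ℝ (Fin d))} (hA : Bornology.IsBounded A) {δ : ℝ} (hδ : 0 < δ)
    (hAδ : ∀ x ∈ A, δ ≤ ‖x‖) (hne : A.Nonempty) :
    ∫ x in A, ν ‖x‖ ≤ ν δ *
      (diam A ^ d * volume.real (closedBall (0 : EuclideanSpace ℝ (Fin d)) 1)) := by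
  obtain ⟨x₀, hx₀⟩ := hne
  have hsub : A ⊆ closedBall x₀ (diam A) := fun x hx =>
    mem_closedBall.2 (dist_le_diam_of_mem hA hx hx₀)
  calc ∫ x in A, ν ‖x‖ ≤ ‖∫ x in A, ν ‖x‖‖ := Real.le_norm_self _
    _ ≤ ν δ * volume.real A := by
        refine norm_setIntegral_le_of_norm_le_const hA.measure_lt_top fun x hx => ?_
        have hx0 : 0 < ‖x‖ := hδ.trans_le (hAδ x hx)
        rw [Real.norm_of_nonneg (H.ν_pos _ hx0).le]
        exact H.ν_anti hδ hx0 (hAδ x hx)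
    _ ≤ ν δ * volume.real (closedBall x₀ (diam A)) :=
        mul_le_mul_of_nonneg_left (measureReal_mono hsub measure_closedBall_lt_top.ne)
          (H.ν_pos δ hδ).le
    _ = _ := by rw [Measure.addHaar_real_closedBall' _ _ diam_nonneg, finrank_euclideanSpace_fin]

theorem setIntegral_nu1_le (H : NuAssumptions d ν a b β ℓ a₃ α₃)
    {A : Set (EuclideanSpace ℝ (Fin (d + 2)))} (hAm : MeasurableSet A)
    (hA : Bornology.IsBounded A) {δ : ℝ} (hδ : 0 < δ) (hAδ : ∀ x ∈ A, δ ≤ ‖x‖)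
    (hne : A.Nonempty) :
    ∫ x in A, nu1 ν ‖x‖ ≤ (d + 2) * (2 ^ (d + 3) * diam A ^ (d + 1)) *
      volume.real (closedBall (0 : EuclideanSpace ℝ (Fin (d + 2))) 1) * (ν δ / δ) := by
  rcases (diam_nonneg (s := A)).eq_or_lt with hD | hD
  · have hsing : A.Subsingleton := fun x hx y hy =>
      dist_le_zero.1 ((dist_le_diam_of_mem hA hx hy).trans hD.ge)
    rw [Measure.restrict_eq_zero.2 (hsing.measure_zero _), ← hD]
    simp
  obtain ⟨R, hR⟩ := hA.exists_norm_le
  have hδR : δ ≤ R := hne.elim fun x hx => (hAδ x hx).trans (hR x hx)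
  have hprofile : ∫⁻ r in Icc δ R, ENNReal.ofReal (nu1 ν r) ≤ ENNReal.ofReal (ν δ / δ) := by
    calc ∫⁻ r in Icc δ R, ENNReal.ofReal (nu1 ν r)
        ≤ ∫⁻ r in Icc δ R, ENNReal.ofReal δ⁻¹ * ENNReal.ofReal (-deriv ν r) := by
          refine setLIntegral_mono' measurableSet_Icc fun r hr => ?_
          rw [← ENNReal.ofReal_mul (by positivity)]
          apply ENNReal.ofReal_le_ofReal
          rw [nu1, inv_mul_eq_div]
          have := H.deriv_nonpos (hδ.trans_le hr.1)
          have hr0 : 0 < r := hδ.trans_le hr.1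
          refine div_le_div_of_nonneg_left (by linarith) hδ ?_
          nlinarith [hr.1, Real.pi_gt_three]
      _ = ENNReal.ofReal δ⁻¹ * ∫⁻ r in Icc δ R, ENNReal.ofReal (-deriv ν r) :=
          lintegral_const_mul _ (measurable_deriv ν).neg.ennreal_ofReal
      _ ≤ ENNReal.ofReal δ⁻¹ * ENNReal.ofReal (ν δ) := by
          gcongr
          exact H.setLIntegral_neg_deriv_le hδ hδR
      _ = ENNReal.ofReal (ν δ / δ) := by
          rw [← ENNReal.ofReal_mul (by positivity), inv_mul_eq_div]
  have hlint := setLIntegral_fun_norm_le volume (n := d + 1) finrank_euclideanSpace_fin hAm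
    (measurable_nu1 ν).ennreal_ofReal hD (fun x hx => ⟨hAδ x hx, hR x hx⟩)
    (fun x hx y hy => dist_le_diam_of_mem hA hx hy)
  have hmeas : Measurable fun x : EuclideanSpace ℝ (Fin (d + 2)) => nu1 ν ‖x‖ :=
    (measurable_nu1 ν).comp measurable_norm
  rw [integral_eq_lintegral_of_nonneg_ae _ hmeas.aestronglyMeasurable]
  · have hν := (H.ν_pos δ hδ).le
    refine ENNReal.toReal_le_of_le_ofReal (by positivity) ((hlint.trans
      (mul_le_mul_right hprofile _)).trans_eq ?_)
    have hcoef : ((d + 1 : ℕ) : ENNReal) + 1 = ENNReal.ofReal (d + 2) := by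
      rw [← ENNReal.ofReal_natCast, ← ENNReal.ofReal_one,
        ← ENNReal.ofReal_add (by positivity) zero_le_one]
      push_cast
      ring_nf
    rw [hcoef, ← ENNReal.ofReal_mul (by positivity),
      ← ofReal_measureReal measure_closedBall_lt_top.ne, ← ENNReal.ofReal_mul (by positivity),
      ← ENNReal.ofReal_mul (by positivity)]
  · filter_upwards [ae_restrict_mem hAm] with x hx
    exact H.nu1_nonneg (hδ.trans_le (hAδ x hx))

end NuAssumptions

/-- condition (D): infiniteness of ν and ν₁ and the bounds
ν(A) ≤ c f̃(δ(A)) diam(A)^d and ν₁(A) ≤ c f(δ(A)) diam(A)^{d+1}. -/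
theorem condition_D (d : ℕ) (hd : 0 < d) (ν : ℝ → ℝ) (a b β ℓ a₃ α₃ : ℝ)
    (H : NuAssumptions d ν a b β ℓ a₃ α₃) :
    (∫⁻ y : EuclideanSpace ℝ (Fin d), ENNReal.ofReal (ν ‖y‖)) = ⊤
    ∧ (∫⁻ y : EuclideanSpace ℝ (Fin (d + 2)), ENNReal.ofReal (nu1 ν ‖y‖)) = ⊤
    ∧ ∃ c : ℝ, 0 < c ∧
      (∀ A : Set (EuclideanSpace ℝ (Fin d)), MeasurableSet A → Bornology.IsBounded A →
        0 < sInf ((fun y => ‖y‖) '' A) →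
        (∫ x in A, ν ‖x‖)
          ≤ c * ftil d ν b β ℓ (sInf ((fun y => ‖y‖) '' A)) * Metric.diam A ^ d)
      ∧ (∀ A : Set (EuclideanSpace ℝ (Fin (d + 2))), MeasurableSet A → Bornology.IsBounded A →
        0 < sInf ((fun y => ‖y‖) '' A) →
        (∫ x in A, nu1 ν ‖x‖)
          ≤ c * ffun d ν b β ℓ (sInf ((fun y => ‖y‖) '' A)) * Metric.diam A ^ (d + 1)) := by
  refine ⟨H.lintegral_nu_eq_top hd, H.lintegral_nu1_eq_top hd, ?_⟩
  set C := a + (d + 2) * ∫ s in Ioo (0 : ℝ) 1, s ^ (d + 1) * ν s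
  set V := volume.real (closedBall (0 : EuclideanSpace ℝ (Fin d)) 1)
  set W := volume.real (closedBall (0 : EuclideanSpace ℝ (Fin (d + 2))) 1)
  have hC : 0 < C := by
    have := H.ha
    have := H.setIntegral_pos one_pos le_rfl
    positivity
  have hV : 0 ≤ V := measureReal_nonneg
  have hW : 0 ≤ W := measureReal_nonneg
  have hne : ∀ {n : ℕ} {A : Set (EuclideanSpace ℝ (Fin n))},
      0 < sInf ((fun y => ‖y‖) '' A) → A.Nonempty := by
    intro n A hδ
    by_contra h
    rw [not_nonempty_iff_eq_empty.1 h, image_empty, Real.sInf_empty] at hδ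
    exact hδ.false
  have hinf : ∀ {n : ℕ} {A : Set (EuclideanSpace ℝ (Fin n))},
      ∀ x ∈ A, sInf ((fun y => ‖y‖) '' A) ≤ ‖x‖ := fun x hx =>
    csInf_le ⟨0, by rintro _ ⟨y, -, rfl⟩; exact norm_nonneg y⟩ (mem_image_of_mem _ hx)
  refine ⟨C * (V + (d + 2) * 2 ^ (d + 3) * W + 1), by positivity, ?_, ?_⟩
  · intro A _ hA hδ
    set δ := sInf ((fun y => ‖y‖) '' A)
    have hf := H.ftil_nonneg hδ
    have hD : 0 ≤ diam A := diam_nonneg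
    calc ∫ x in A, ν ‖x‖ ≤ ν δ * (diam A ^ d * V) := H.setIntegral_nu_le hA hδ hinf (hne hδ)
      _ ≤ C * ftil d ν b β ℓ δ * (diam A ^ d * V) := by
          gcongr
          exact H.nu_le_mul_ftil hδ
      _ = C * V * ftil d ν b β ℓ δ * diam A ^ d := by ring
      _ ≤ C * (V + (d + 2) * 2 ^ (d + 3) * W + 1) * ftil d ν b β ℓ δ * diam A ^ d := by
          gcongr
          have : 0 ≤ (d + 2) * 2 ^ (d + 3) * W := by positivity
          linarith
  · intro A hAm hA hδ
    set δ := sInf ((fun y => ‖y‖) '' A)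
    have hf := H.ftil_nonneg hδ
    have hD : 0 ≤ diam A := diam_nonneg
    rw [NuAssumptions.ffun_eq_ftil_div ν b β ℓ hδ]
    calc ∫ x in A, nu1 ν ‖x‖ ≤ (d + 2) * (2 ^ (d + 3) * diam A ^ (d + 1)) * W * (ν δ / δ) :=
          H.setIntegral_nu1_le hAm hA hδ hinf (hne hδ)
      _ ≤ (d + 2) * (2 ^ (d + 3) * diam A ^ (d + 1)) * W * (C * ftil d ν b β ℓ δ / δ) := by
          gcongr
          exact H.nu_le_mul_ftil hδ
      _ = C * ((d + 2) * 2 ^ (d + 3) * W) * (ftil d ν b β ℓ δ / δ) * diam A ^ (d + 1) := by ring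
      _ ≤ C * (V + (d + 2) * 2 ^ (d + 3) * W + 1) * (ftil d ν b β ℓ δ / δ) *
          diam A ^ (d + 1) := by
          gcongr
          linarith
end

section
/- Assume ν satisfies (N1) and (N2). Then for every κ ∈ (0,1) there exists a constant c = c(κ) > 0 such that for all r > 0: ∫_{{y ∈ ℝ^d : |y| > r}} exp(b κ |y|^β) ν(|y|) dy ≤ c Ψ(1/r) and ∫_{{y ∈ ℝ^{d+2} : |y| > r}} exp(b κ |y|^β) ν₁(|y|) dy ≤ c Ψ(1/r). -/
open MeasureTheory Filter Set

attribute [local instance] Classical.propDecidable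

lemma integral_norm_gt_eq (n : ℕ) (hn : 0 < n) (f : ℝ → ℝ) {r : ℝ} (hr : 0 < r) :
    ∫ y in {y : EuclideanSpace ℝ (Fin n) | r < ‖y‖}, f ‖y‖ =
      n * volume.real (Metric.ball (0 : EuclideanSpace ℝ (Fin n)) 1) *
        ∫ s in Ioi r, s ^ (n - 1) * f s := by
  have : Nonempty (Fin n) := ⟨⟨0, hn⟩⟩
  have hmeas : MeasurableSet {y : EuclideanSpace ℝ (Fin n) | r < ‖y‖} :=
    measurableSet_lt measurable_const measurable_norm
  have hind : ∀ y : EuclideanSpace ℝ (Fin n),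
      ({y : EuclideanSpace ℝ (Fin n) | r < ‖y‖}.indicator fun y => f ‖y‖) y =
        (Ioi r).indicator f ‖y‖ := fun y => by simp [indicator]
  rw [← integral_indicator hmeas, integral_congr_ae (Eventually.of_forall hind),
    integral_fun_norm_addHaar]
  have hmul : ∀ s : ℝ, s ^ (n - 1) • (Ioi r).indicator f s =
      (Ioi r).indicator (fun s => s ^ (n - 1) * f s) s := fun s => by
    by_cases hs : s ∈ Ioi r <;> simp [hs]
  simp only [finrank_euclideanSpace, Fintype.card_fin, hmul]
  rw [setIntegral_indicator measurableSet_Ioi, inter_eq_self_of_subset_right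
    (Ioi_subset_Ioi hr.le)]
  simp [mul_assoc]

lemma inv_phiHat (d : ℕ) (ν : ℝ → ℝ) (r : ℝ) :
    (phiHat d ν r)⁻¹ = (∫ s in Ioo (0 : ℝ) (min r 1), s ^ (d + 1) * ν s) / r ^ 2 := by
  unfold phiHat
  split_ifs with h
  · rw [min_eq_left h, inv_div]
  · rw [min_eq_right (not_le.1 h).le, mul_inv, one_div, inv_inv, div_eq_mul_inv]

namespace NuAssumptions

variable {d : ℕ} {ν : ℝ → ℝ} {a b β ℓ a₃ α₃ : ℝ}

lemma integrableOn_pow_mul (H : NuAssumptions d ν a b β ℓ a₃ α₃) (hd : 0 < d) {m : ℝ}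
    (hm : m ≤ 1) : IntegrableOn (fun s => s ^ (d + 1) * ν s) (Ioo 0 m) := by
  have : Nonempty (Fin d) := ⟨⟨0, hd⟩⟩
  have h := (integrable_fun_norm_addHaar (E := EuclideanSpace ℝ (Fin d)) volume
    (f := fun s : ℝ => min 1 (s ^ 2) * ν s)).1 H.ν_int
  refine (h.mono_set Ioo_subset_Ioi_self).congr_fun (fun s hs => ?_) measurableSet_Ioo
  have hs1 : s ^ 2 ≤ 1 := pow_le_one₀ hs.1.le (hs.2.le.trans hm)
  have hpow : s ^ (d + 1) = s ^ (d - 1) * s ^ 2 := by rw [← pow_add]; congr 1; omega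
  simp only [finrank_euclideanSpace, Fintype.card_fin, min_eq_right hs1, smul_eq_mul, hpow]
  ring

lemma mul_pow_le_integral (H : NuAssumptions d ν a b β ℓ a₃ α₃) (hd : 0 < d) {m : ℝ}
    (hm0 : 0 < m) (hm : m ≤ 1) :
    ν m * (m ^ (d + 2) / (d + 2)) ≤ ∫ s in Ioo (0 : ℝ) m, s ^ (d + 1) * ν s := by
  have hpow : ∫ s in Ioo (0 : ℝ) m, s ^ (d + 1) = m ^ (d + 2) / (d + 2) := by
    rw [← integral_Ioc_eq_integral_Ioo, ← intervalIntegral.integral_of_le hm0.le, integral_pow]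
    push_cast
    simp
    ring
  rw [← hpow, mul_comm, ← integral_mul_const]
  refine setIntegral_mono_on ?_ (H.integrableOn_pow_mul hd hm) measurableSet_Ioo fun s hs => ?_
  · exact ((by fun_prop : Continuous fun s : ℝ => s ^ (d + 1) * ν m).integrableOn_Icc
      (a := 0) (b := m)).mono_set Ioo_subset_Icc_self
  · exact mul_le_mul_of_nonneg_left (H.ν_anti hs.1 hm0 hs.2.le) (pow_nonneg hs.1.le _)

lemma phiHat_pos (H : NuAssumptions d ν a b β ℓ a₃ α₃) (hd : 0 < d) {r : ℝ} (hr : 0 < r) :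
    0 < phiHat d ν r := by
  rw [← inv_pos, inv_phiHat]
  have hm : 0 < min r 1 := lt_min hr one_pos
  have := H.ν_pos _ hm
  exact div_pos (lt_of_lt_of_le (by positivity) (H.mul_pow_le_integral hd hm (min_le_right _ _)))
    (by positivity)

lemma psi_integrand_bound (d : ℕ) (i : Fin d) {s R : ℝ} (hs : 0 < s) (hsR : s ≤ R)
    (z : EuclideanSpace ℝ (Fin d)) :
    1 - Real.cos (s * z i) ≤ (2 + R ^ 2) * min 1 (‖z‖ ^ 2) := by
  have hzi : z i ^ 2 ≤ ‖z‖ ^ 2 := by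
    rw [sq_le_sq, abs_norm, ← Real.norm_eq_abs]
    exact PiLp.norm_apply_le z i
  rcases min_cases 1 (‖z‖ ^ 2) with ⟨h, -⟩ | ⟨h, -⟩ <;> rw [h]
  · nlinarith [Real.neg_one_le_cos (s * z i), sq_nonneg R]
  · have h1 := Real.one_sub_sq_div_two_le_cos (x := s * z i)
    have h2 : s ^ 2 ≤ R ^ 2 := pow_le_pow_left₀ hs.le hsR 2
    have h3 : s ^ 2 * z i ^ 2 ≤ R ^ 2 * ‖z‖ ^ 2 := by gcongr
    nlinarith [sq_nonneg (s * z i), sq_nonneg ‖z‖]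

lemma integrable_psi (H : NuAssumptions d ν a b β ℓ a₃ α₃) (i : Fin d) {s : ℝ} (hs : 0 < s) :
    Integrable fun z : EuclideanSpace ℝ (Fin d) => (1 - Real.cos (s * z i)) * ν ‖z‖ := by
  have h := H.ν_int.bdd_mul (c := 2 + s ^ 2)
    (f := fun z => (1 - Real.cos (s * z i)) / min 1 (‖z‖ ^ 2)) ?_ ?_
  · refine h.congr (Eventually.of_forall fun z => ?_)
    rcases eq_or_ne z 0 with rfl | hz
    · simp
    · have : 0 < min 1 (‖z‖ ^ 2) := lt_min one_pos (by positivity)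
      simp only
      field_simp
  · exact Measurable.aestronglyMeasurable (by fun_prop)
  · refine Eventually.of_forall fun z => ?_
    have h0 : 0 ≤ min 1 (‖z‖ ^ 2) := le_min one_pos.le (by positivity)
    rw [Real.norm_of_nonneg (div_nonneg (by linarith [Real.cos_le_one (s * z i)]) h0)]
    exact div_le_of_le_mul₀ h0 (by positivity) (psi_integrand_bound d i hs le_rfl z)

lemma psi_nonneg_s17 (H : NuAssumptions d ν a b β ℓ a₃ α₃) (hd : 0 < d) (s : ℝ) :
    0 ≤ psi d hd ν s := by
  refine integral_nonneg fun z => ?_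
  rcases eq_or_ne z 0 with rfl | hz
  · simp
  · exact mul_nonneg (by linarith [Real.cos_le_one (s * z ⟨0, hd⟩)])
      (H.ν_pos _ (norm_pos_iff.2 hz)).le

lemma Psi_nonneg (H : NuAssumptions d ν a b β ℓ a₃ α₃) (hd : 0 < d) (R : ℝ) :
    0 ≤ Psi d hd ν R := by
  refine Real.sSup_nonneg ?_
  rintro _ ⟨s, -, rfl⟩
  exact H.psi_nonneg_s17 hd s

lemma psi_le_Psi (H : NuAssumptions d ν a b β ℓ a₃ α₃) (hd : 0 < d) {R : ℝ} (hR : 0 < R) :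
    psi d hd ν R ≤ Psi d hd ν R := by
  refine le_csSup ⟨∫ z : EuclideanSpace ℝ (Fin d), (2 + R ^ 2) * (min 1 (‖z‖ ^ 2) * ν ‖z‖), ?_⟩
    ⟨R, ⟨hR, le_rfl⟩, rfl⟩
  rintro _ ⟨s, hs, rfl⟩
  refine integral_mono (H.integrable_psi _ hs.1) (H.ν_int.const_mul _) fun z => ?_
  rcases eq_or_ne z 0 with rfl | hz
  · simp
  · simp only
    rw [← mul_assoc]
    exact mul_le_mul_of_nonneg_right (psi_integrand_bound d _ hs.1 hs.2 z)
      (H.ν_pos _ (norm_pos_iff.2 hz)).le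

/-- The radial part of `‖z‖² ν(‖z‖)` truncated to the ball of radius `m`. -/
lemma integral_norm_sq_truncated (hd : 0 < d) (ν : ℝ → ℝ) (m : ℝ) :
    ∫ z : EuclideanSpace ℝ (Fin d), ‖z‖ ^ 2 * (Iio m).indicator ν ‖z‖ =
      d * volume.real (Metric.ball (0 : EuclideanSpace ℝ (Fin d)) 1) *
        ∫ s in Ioo (0 : ℝ) m, s ^ (d + 1) * ν s := by
  have : Nonempty (Fin d) := ⟨⟨0, hd⟩⟩
  rw [integral_fun_norm_addHaar volume (fun s : ℝ => s ^ 2 * (Iio m).indicator ν s)]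
  have hpow : ∀ s : ℝ, s ^ (d + 1) = s ^ (d - 1) * s ^ 2 := fun s => by
    rw [← pow_add]; congr 1; omega
  have hmul : ∀ s : ℝ, s ^ (d - 1) • (s ^ 2 * (Iio m).indicator ν s) =
      (Iio m).indicator (fun s => s ^ (d + 1) * ν s) s := fun s => by
    by_cases hs : s ∈ Iio m <;> simp [hs, hpow, mul_assoc]
  simp only [finrank_euclideanSpace, Fintype.card_fin, hmul]
  rw [setIntegral_indicator measurableSet_Iio, Ioi_inter_Iio]
  simp [mul_assoc]

lemma integrable_coord_sq_truncated (H : NuAssumptions d ν a b β ℓ a₃ α₃) {m : ℝ} (hm : m ≤ 1)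
    (i : Fin d) :
    Integrable fun z : EuclideanSpace ℝ (Fin d) => z i ^ 2 * (Iio m).indicator ν ‖z‖ := by
  have hball : MeasurableSet {z : EuclideanSpace ℝ (Fin d) | ‖z‖ < m} :=
    measurableSet_lt measurable_norm measurable_const
  have h := (H.ν_int.indicator hball).bdd_mul (c := 1)
    (f := fun z => z i ^ 2 / ‖z‖ ^ 2) ?_ ?_
  · refine h.congr (Eventually.of_forall fun z => ?_)
    rcases eq_or_ne z 0 with rfl | hz
    · simp
    · by_cases hzm : ‖z‖ < m
      · have h1 : ‖z‖ ^ 2 ≤ 1 := pow_le_one₀ (norm_nonneg z) (hzm.le.trans hm)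
        have h2 : ‖z‖ ≠ 0 := norm_ne_zero_iff.2 hz
        simp only [indicator, mem_ofPred_eq, mem_Iio, hzm, if_true, min_eq_right h1]
        field_simp
      · simp [indicator, hzm]
  · exact Measurable.aestronglyMeasurable (by fun_prop)
  · refine Eventually.of_forall fun z => ?_
    rw [Real.norm_of_nonneg (by positivity)]
    refine div_le_one_of_le₀ ?_ (by positivity)
    rw [sq_le_sq, abs_norm, ← Real.norm_eq_abs]
    exact PiLp.norm_apply_le z i

lemma integral_coord_sq_radial_eq (f : ℝ → ℝ) (i j : Fin d) :
    ∫ z : EuclideanSpace ℝ (Fin d), z i ^ 2 * f ‖z‖ =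
      ∫ z : EuclideanSpace ℝ (Fin d), z j ^ 2 * f ‖z‖ := by
  let e := LinearIsometryEquiv.piLpCongrLeft 2 ℝ ℝ (Equiv.swap i j)
  have he : MeasurePreserving e.toMeasurableEquiv volume volume := e.measurePreserving
  rw [← he.integral_comp' fun z : EuclideanSpace ℝ (Fin d) => z i ^ 2 * f ‖z‖]
  refine integral_congr_ae (Eventually.of_forall fun z => ?_)
  have h1 : ‖e.toMeasurableEquiv z‖ = ‖z‖ := e.norm_map z
  have h2 : (e.toMeasurableEquiv z) i = z j := by
    change (LinearIsometryEquiv.piLpCongrLeft 2 ℝ ℝ (Equiv.swap i j) z) i = z j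
    simp [LinearIsometryEquiv.piLpCongrLeft_apply, Equiv.piCongrLeft']
  simp only [h1, h2]

lemma integral_coord_sq_truncated (H : NuAssumptions d ν a b β ℓ a₃ α₃) (hd : 0 < d) {m : ℝ}
    (hm : m ≤ 1) (i : Fin d) :
    ∫ z : EuclideanSpace ℝ (Fin d), z i ^ 2 * (Iio m).indicator ν ‖z‖ =
      volume.real (Metric.ball (0 : EuclideanSpace ℝ (Fin d)) 1) *
        ∫ s in Ioo (0 : ℝ) m, s ^ (d + 1) * ν s := by
  have h := integral_norm_sq_truncated hd ν m
  simp only [EuclideanSpace.real_norm_sq_eq, Finset.sum_mul] at h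
  rw [integral_finsetSum _ fun j _ => H.integrable_coord_sq_truncated hm j] at h
  simp only [integral_coord_sq_radial_eq _ _ i, Finset.sum_const, Finset.card_univ,
    Fintype.card_fin, nsmul_eq_mul, mul_assoc] at h
  exact mul_left_cancel₀ (Nat.cast_ne_zero.2 hd.ne') h

lemma inv_phiHat_le_psi (H : NuAssumptions d ν a b β ℓ a₃ α₃) (hd : 0 < d) {r : ℝ}
    (hr : 0 < r) :
    2 / Real.pi ^ 2 * volume.real (Metric.ball (0 : EuclideanSpace ℝ (Fin d)) 1) *
      (phiHat d ν r)⁻¹ ≤ psi d hd ν (1 / r) := by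
  have hpi := Real.pi_pos
  calc _ = ∫ z : EuclideanSpace ℝ (Fin d), 2 / Real.pi ^ 2 / r ^ 2 *
        (z ⟨0, hd⟩ ^ 2 * (Iio (min r 1)).indicator ν ‖z‖) := by
        rw [integral_const_mul, H.integral_coord_sq_truncated hd (min_le_right _ _), inv_phiHat]
        ring
    _ ≤ _ := by
        refine integral_mono ((H.integrable_coord_sq_truncated (min_le_right _ _) _).const_mul _)
          (H.integrable_psi _ (by positivity)) fun z => ?_
        simp only
        have hcos := Real.cos_le_one (1 / r * z ⟨0, hd⟩)
        rcases eq_or_ne z 0 with rfl | hz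
        · simp
        have hν := H.ν_pos _ (norm_pos_iff.2 hz)
        by_cases hzm : ‖z‖ < min r 1
        · rw [indicator_of_mem (by exact hzm), ← mul_assoc]
          refine mul_le_mul_of_nonneg_right ?_ hν.le
          have hzr : |z ⟨0, hd⟩| ≤ r := by
            rw [← Real.norm_eq_abs]
            exact (PiLp.norm_apply_le z _).trans (hzm.le.trans (min_le_left _ _))
          have habs : |1 / r * z ⟨0, hd⟩| ≤ Real.pi := by
            rw [abs_mul, abs_of_pos (by positivity), one_div_mul_eq_div]
            exact ((div_le_one hr).2 hzr).trans (by linarith [Real.pi_gt_three])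
          have := Real.cos_le_one_sub_mul_cos_sq habs
          have heq : 2 / Real.pi ^ 2 / r ^ 2 * z ⟨0, hd⟩ ^ 2 =
            2 / Real.pi ^ 2 * (1 / r * z ⟨0, hd⟩) ^ 2 := by field_simp
          linarith
        · rw [indicator_of_notMem (by exact hzm), mul_zero, mul_zero]
          exact mul_nonneg (by linarith) hν.le

lemma exists_inv_phiHat_le_Psi (H : NuAssumptions d ν a b β ℓ a₃ α₃) (hd : 0 < d) :
    ∃ C : ℝ, 0 < C ∧ ∀ r : ℝ, 0 < r → (phiHat d ν r)⁻¹ ≤ C * Psi d hd ν (1 / r) := by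
  have hball : 0 < volume.real (Metric.ball (0 : EuclideanSpace ℝ (Fin d)) 1) :=
    ENNReal.toReal_pos (Metric.measure_ball_pos _ _ one_pos).ne' measure_ball_lt_top.ne
  have hpi := Real.pi_pos
  set A := 2 / Real.pi ^ 2 * volume.real (Metric.ball (0 : EuclideanSpace ℝ (Fin d)) 1)
  have hA : 0 < A := by positivity
  refine ⟨A⁻¹, inv_pos.2 hA, fun r hr => ?_⟩
  rw [← div_eq_inv_mul, le_div_iff₀' hA]
  exact (H.inv_phiHat_le_psi hd hr).trans (H.psi_le_Psi hd (by positivity))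

lemma exists_pow_le_exp_rpow (n : ℕ) {c β : ℝ} (hc : 0 < c) (hβ : 0 < β) :
    ∃ C : ℝ, 0 < C ∧ ∀ x : ℝ, 1 ≤ x → x ^ n ≤ C * Real.exp (c * x ^ β) := by
  obtain ⟨k, hk⟩ := exists_nat_ge (n / β)
  refine ⟨k.factorial / c ^ k, by positivity, fun x hx => ?_⟩
  have hx0 : 0 < x := one_pos.trans_le hx
  have h1 := Real.pow_div_factorial_le_exp (c * x ^ β) (by positivity) k
  have h2 : x ^ n ≤ (x ^ β) ^ k := by
    rw [← Real.rpow_natCast, ← Real.rpow_natCast, ← Real.rpow_mul hx0.le]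
    exact Real.rpow_le_rpow_of_exponent_le hx (by rwa [div_le_iff₀' hβ] at hk)
  refine h2.trans ?_
  rw [mul_pow, div_le_iff₀ (by positivity)] at h1
  rw [div_mul_eq_mul_div, le_div_iff₀ (by positivity)]
  linarith

lemma exists_pow_mul_exp_mul_le (H : NuAssumptions d ν a b β ℓ a₃ α₃) (hd : 0 < d) {κ : ℝ}
    (hκ0 : 0 < κ) (hκ1 : κ < 1) :
    ∃ C : ℝ, 0 < C ∧ ∀ ρ : ℝ, 0 < ρ →
      ρ ^ d * Real.exp (b * κ * ρ ^ β) * ν ρ ≤ C * (phiHat d ν ρ)⁻¹ := by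
  have hb := H.hb
  have ha := H.ha
  obtain ⟨K, hK0, hK⟩ := exists_pow_le_exp_rpow (d + 2)
    (mul_pos hb (sub_pos.2 hκ1)) H.β_pos
  have hφ := H.phiHat_pos hd one_pos
  refine ⟨max (Real.exp (b * κ) * (d + 2)) (a * K * phiHat d ν 1), by positivity,
    fun ρ hρ => ?_⟩
  have hφρ := inv_pos.2 (H.phiHat_pos hd hρ)
  have hν := H.ν_pos ρ hρ
  rcases le_or_gt ρ 1 with h1 | h1
  · refine le_trans ?_ (mul_le_mul_of_nonneg_right (le_max_left _ _) hφρ.le)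
    have hexp : Real.exp (b * κ * ρ ^ β) ≤ Real.exp (b * κ) := by
      refine Real.exp_le_exp.2 (mul_le_of_le_one_right (by positivity) ?_)
      exact Real.rpow_le_one hρ.le h1 H.β_pos.le
    have hI : ρ ^ d * ν ρ ≤ (d + 2) * (phiHat d ν ρ)⁻¹ := by
      have := H.mul_pow_le_integral hd hρ h1
      rw [inv_phiHat, min_eq_left h1, mul_div_assoc', le_div_iff₀ (by positivity)]
      rw [mul_div_assoc', div_le_iff₀ (by positivity)] at this
      calc _ = ν ρ * ρ ^ (d + 2) := by ring
        _ ≤ _ := by linarith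
    calc _ = Real.exp (b * κ * ρ ^ β) * (ρ ^ d * ν ρ) := by ring
      _ ≤ Real.exp (b * κ) * ((d + 2) * (phiHat d ν ρ)⁻¹) := by gcongr
      _ = _ := by ring
  · refine le_trans ?_ (mul_le_mul_of_nonneg_right (le_max_right _ _) hφρ.le)
    have hinv : (phiHat d ν ρ)⁻¹ = (phiHat d ν 1)⁻¹ / ρ ^ 2 := by
      rw [inv_phiHat, inv_phiHat, min_eq_right h1.le, min_self]; simp
    have hνle : ν ρ ≤ a * Real.exp (-b * ρ ^ β) := by
      refine (H.hN1 ρ h1).trans ?_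
      have := Real.rpow_le_one_of_one_le_of_nonpos h1.le (neg_nonpos.2 H.ℓ_nonneg)
      exact mul_le_mul_of_nonneg_right (mul_le_of_le_one_right ha.le this) (Real.exp_pos _).le
    have hexp : Real.exp (b * (1 - κ) * ρ ^ β) * Real.exp (b * κ * ρ ^ β) *
        Real.exp (-b * ρ ^ β) = 1 := by
      rw [← Real.exp_add, ← Real.exp_add, Real.exp_eq_one_iff]
      ring
    have hmain : ρ ^ (d + 2) * Real.exp (b * κ * ρ ^ β) * ν ρ ≤ a * K := by
      calc _ ≤ (K * Real.exp (b * (1 - κ) * ρ ^ β)) * Real.exp (b * κ * ρ ^ β) *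
            (a * Real.exp (-b * ρ ^ β)) := by
            gcongr
            exact hK ρ h1.le
        _ = a * K * (Real.exp (b * (1 - κ) * ρ ^ β) * Real.exp (b * κ * ρ ^ β) *
            Real.exp (-b * ρ ^ β)) := by ring
        _ = a * K := by rw [hexp, mul_one]
    rw [hinv, mul_assoc (a * K), mul_div_assoc', mul_inv_cancel₀ hφ.ne', mul_one_div,
      le_div_iff₀ (by positivity)]
    calc _ = ρ ^ (d + 2) * Real.exp (b * κ * ρ ^ β) * ν ρ := by ring
      _ ≤ _ := hmain

lemma exists_pow_mul_exp_mul_le_decay (H : NuAssumptions d ν a b β ℓ a₃ α₃) (hd : 0 < d)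
    {κ : ℝ} (hκ0 : 0 < κ) (hκ1 : κ < 1) :
    ∃ C : ℝ, 0 < C ∧ ∀ r ρ : ℝ, 0 < r → r ≤ ρ →
      ρ ^ d * Real.exp (b * κ * ρ ^ β) * ν ρ ≤ C * (phiHat d ν r)⁻¹ * (r / ρ) ^ α₃ := by
  obtain ⟨C, hC0, hC⟩ := H.exists_pow_mul_exp_mul_le hd hκ0 hκ1
  have ha₃ := H.a₃_pos
  refine ⟨C / a₃, by positivity, fun r ρ hr hrρ => (hC ρ (hr.trans_le hrρ)).trans ?_⟩
  have hρ := hr.trans_le hrρ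
  have h1 := H.phiHat_pos hd hr
  have h2 := H.phiHat_pos hd hρ
  have h3 := H.hN2 r ρ hr hrρ
  have h4 : (r / ρ) ^ α₃ = ((ρ / r) ^ α₃)⁻¹ := by
    rw [← Real.inv_rpow (by positivity), inv_div]
  have h5 : 0 < (ρ / r) ^ α₃ := by positivity
  rw [h4]
  rw [le_div_iff₀ h1] at h3
  calc C * (phiHat d ν ρ)⁻¹ ≤ C * (a₃ * (ρ / r) ^ α₃ * phiHat d ν r)⁻¹ := by gcongr
    _ = _ := by field_simp

lemma integral_Ioi_le_of_decay {g : ℝ → ℝ} {B α r : ℝ} (hr : 0 < r) (hα : 0 < α)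
    (hg : ContinuousOn g (Ioi r)) (hg0 : ∀ x ∈ Ioi r, 0 ≤ g x)
    (hgB : ∀ x ∈ Ioi r, g x ≤ B * (r / x) ^ α * x⁻¹) :
    IntegrableOn g (Ioi r) ∧ ∫ x in Ioi r, g x ≤ B / α := by
  have hlt : -α - 1 < -1 := by linarith
  have hint := (integrableOn_Ioi_rpow_of_lt hlt hr).const_mul (B * r ^ α)
  have heq : ∀ x ∈ Ioi r, g x ≤ B * r ^ α * x ^ (-α - 1) := fun x hx => by
    have hx0 : 0 < x := hr.trans hx
    refine (hgB x hx).trans_eq ?_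
    rw [Real.div_rpow hr.le hx0.le, Real.rpow_sub hx0, Real.rpow_neg hx0.le, Real.rpow_one]
    ring
  have hgi : IntegrableOn g (Ioi r) := by
    refine hint.mono' (hg.aestronglyMeasurable measurableSet_Ioi) ?_
    filter_upwards [ae_restrict_mem measurableSet_Ioi] with x hx
    rw [Real.norm_of_nonneg (hg0 x hx)]
    exact heq x hx
  refine ⟨hgi, (setIntegral_mono_on hgi hint measurableSet_Ioi heq).trans_eq ?_⟩
  rw [integral_const_mul, integral_Ioi_rpow_of_lt hlt hr]
  have hra : r ^ α * r ^ (-α) = 1 := by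
    rw [← Real.rpow_add hr, add_neg_cancel, Real.rpow_zero]
  rw [show -α - 1 + 1 = -α by ring, neg_div_neg_eq, mul_div_assoc', mul_assoc, hra, mul_one]

lemma continuousOn_Ioi (H : NuAssumptions d ν a b β ℓ a₃ α₃) {r : ℝ} (hr : 0 < r) :
    ContinuousOn ν (Ioi r) := fun x hx =>
  (H.ν_diff x (hr.trans hx)).continuousAt.continuousWithinAt

lemma hasDerivAt_pow_mul_exp (d : ℕ) (c : ℝ) {β x : ℝ} (hx : 0 < x) :
    HasDerivAt (fun x : ℝ => x ^ d * Real.exp (c * x ^ β))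
      ((d + c * β * x ^ β) * (x ^ d * Real.exp (c * x ^ β)) * x⁻¹) x := by
  have h := (hasDerivAt_pow d x).mul
    (((Real.hasDerivAt_rpow_const (p := β) (Or.inl hx.ne')).const_mul c).exp)
  refine h.congr_deriv ?_
  have hpow : (d : ℝ) * x ^ (d - 1) = d * x ^ d * x⁻¹ := by
    rcases d with _ | n
    · simp
    · rw [Nat.add_sub_cancel, pow_succ]; field_simp
  rw [hpow, Real.rpow_sub_one hx.ne']
  ring

lemma exists_integral_exp_mul_le (H : NuAssumptions d ν a b β ℓ a₃ α₃) (hd : 0 < d)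
    {κ : ℝ} (hκ0 : 0 < κ) (hκ1 : κ < 1) :
    ∃ C : ℝ, 0 < C ∧ ∀ r : ℝ, 0 < r →
      ∫ s in Ioi r, s ^ (d - 1) * (Real.exp (b * κ * s ^ β) * ν s) ≤ C * (phiHat d ν r)⁻¹ := by
  obtain ⟨C, hC0, hC⟩ := H.exists_pow_mul_exp_mul_le_decay hd hκ0 hκ1
  have hα := H.α₃_pos
  refine ⟨C / α₃, by positivity, fun r hr => ?_⟩
  have heq : ∀ x ∈ Ioi r, x ^ (d - 1) * (Real.exp (b * κ * x ^ β) * ν x) =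
      x ^ d * Real.exp (b * κ * x ^ β) * ν x * x⁻¹ := fun x hx => by
    have hx0 : 0 < x := hr.trans hx
    rw [← Nat.sub_add_cancel hd, pow_succ]
    simp only [Nat.add_sub_cancel]
    field_simp
  have h := integral_Ioi_le_of_decay (g := fun x : ℝ =>
      x ^ (d - 1) * (Real.exp (b * κ * x ^ β) * ν x)) (B := C * (phiHat d ν r)⁻¹) hr hα ?_ ?_ ?_
  · exact h.2.trans_eq (by ring)
  · have hβ := H.β_pos.le
    exact (by fun_prop : Continuous fun x : ℝ => x ^ (d - 1)).continuousOn.mul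
      ((Real.continuous_exp.comp (continuous_const.mul
        (Real.continuous_rpow_const hβ))).continuousOn.mul (H.continuousOn_Ioi hr))
  · intro x hx
    have hx0 : 0 < x := hr.trans hx
    have := H.ν_pos x hx0
    positivity
  · intro x hx
    have hx0 : 0 < x := hr.trans hx
    rw [heq x hx]
    exact mul_le_mul_of_nonneg_right (hC r x hr (le_of_lt hx)) (by positivity)

lemma exists_integral_exp_mul_neg_deriv_le (H : NuAssumptions d ν a b β ℓ a₃ α₃) (hd : 0 < d)
    {κ : ℝ} (hκ0 : 0 < κ) (hκ1 : κ < 1) :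
    ∃ C : ℝ, 0 < C ∧ ∀ r : ℝ, 0 < r →
      ∫ s in Ioi r, s ^ d * Real.exp (b * κ * s ^ β) * (-deriv ν s) ≤
        C * (phiHat d ν r)⁻¹ := by
  obtain ⟨κ', hκκ', hκ'1⟩ := exists_between hκ1
  obtain ⟨C, hC0, hC⟩ := H.exists_pow_mul_exp_mul_le_decay hd hκ0 hκ1
  obtain ⟨C', hC'0, hC'⟩ := H.exists_pow_mul_exp_mul_le_decay hd (hκ0.trans hκκ') hκ'1
  have hα := H.α₃_pos
  have hb := H.hb
  have hβ := H.β_pos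
  have hδ : 0 < b * (κ' - κ) := mul_pos hb (sub_pos.2 hκκ')
  set B := d * C + b * κ * β / (b * (κ' - κ)) * C' with hB
  refine ⟨C + B / α₃, by positivity, fun r hr => ?_⟩
  have hφ := inv_pos.2 (H.phiHat_pos hd hr)
  set u : ℝ → ℝ := fun x => x ^ d * Real.exp (b * κ * x ^ β) with hu
  set u' : ℝ → ℝ := fun x => (d + b * κ * β * x ^ β) * u x * x⁻¹ with hu'
  have hu_cont : Continuous u := by
    exact (continuous_pow d).mul (Real.continuous_exp.comp (continuous_const.mul
      (Real.continuous_rpow_const hβ.le)))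
  have hu_nonneg : ∀ x, 0 < x → 0 ≤ u x := fun x hx => by positivity
  have hu'_bound : ∀ x ∈ Ioi r,
      u' x * ν x ≤ B * (phiHat d ν r)⁻¹ * (r / x) ^ α₃ * x⁻¹ := by
    intro x hx
    have hx0 : 0 < x := hr.trans hx
    have hν := H.ν_pos x hx0
    have h1 := hC r x hr (le_of_lt hx)
    have h2 := hC' r x hr (le_of_lt hx)
    have h3 : x ^ β * Real.exp (b * κ * x ^ β) ≤
        (b * (κ' - κ))⁻¹ * Real.exp (b * κ' * x ^ β) := by
      have h4 : b * (κ' - κ) * x ^ β ≤ Real.exp (b * (κ' - κ) * x ^ β) := by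
        linarith [Real.add_one_le_exp (b * (κ' - κ) * x ^ β)]
      have h5 : Real.exp (b * κ' * x ^ β) =
          Real.exp (b * (κ' - κ) * x ^ β) * Real.exp (b * κ * x ^ β) := by
        rw [← Real.exp_add]; congr 1; ring
      rw [h5, ← div_eq_inv_mul, le_div_iff₀' hδ, ← mul_assoc]
      exact mul_le_mul_of_nonneg_right h4 (Real.exp_pos _).le
    calc u' x * ν x = (d * (x ^ d * Real.exp (b * κ * x ^ β) * ν x) +
          b * κ * β * (x ^ d * (x ^ β * Real.exp (b * κ * x ^ β)) * ν x)) * x⁻¹ := by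
          simp only [hu', hu]; ring
      _ ≤ (d * (x ^ d * Real.exp (b * κ * x ^ β) * ν x) +
          b * κ * β * (x ^ d * ((b * (κ' - κ))⁻¹ * Real.exp (b * κ' * x ^ β)) * ν x)) * x⁻¹ := by
          gcongr
      _ = (d * (x ^ d * Real.exp (b * κ * x ^ β) * ν x) +
          b * κ * β / (b * (κ' - κ)) * (x ^ d * Real.exp (b * κ' * x ^ β) * ν x)) * x⁻¹ := by
          ring
      _ ≤ (d * (C * (phiHat d ν r)⁻¹ * (r / x) ^ α₃) +
          b * κ * β / (b * (κ' - κ)) * (C' * (phiHat d ν r)⁻¹ * (r / x) ^ α₃)) * x⁻¹ := by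
          gcongr
      _ = _ := by rw [hB]; ring
  obtain ⟨hint, hle⟩ := integral_Ioi_le_of_decay (g := fun x => u' x * ν x) hr hα
    (by
      refine ContinuousOn.mul (ContinuousOn.mul ?_ ?_) (H.continuousOn_Ioi hr)
      · exact ((continuous_const.add (continuous_const.mul
          (Real.continuous_rpow_const hβ.le))).mul hu_cont).continuousOn
      · exact continuousOn_inv₀.mono fun x hx => (hr.trans hx).ne')
    (fun x hx => by
      have hx0 : 0 < x := hr.trans hx
      have := H.ν_pos x hx0
      have := hu_nonneg x hx0
      simp only [hu']
      positivity) hu'_bound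
  have hur : u r * ν r ≤ C * (phiHat d ν r)⁻¹ := by
    simpa [div_self hr.ne'] using hC r r hr le_rfl
  by_cases hv : IntegrableOn (u * fun x => -deriv ν x) (Ioi r)
  swap
  · have : ∫ s in Ioi r, s ^ d * Real.exp (b * κ * s ^ β) * (-deriv ν s) = 0 :=
      integral_undef hv
    rw [this]
    positivity
  have htop : Tendsto (fun x => u x * ν x) atTop (nhds 0) := by
    have hlim : Tendsto (fun x : ℝ => C * (phiHat d ν r)⁻¹ * (r / x) ^ α₃) atTop (nhds 0) := by
      have h1 : Tendsto (fun x : ℝ => (r / x) ^ α₃) atTop (nhds (0 ^ α₃)) :=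
        (tendsto_const_nhds.div_atTop tendsto_id).rpow_const (Or.inr hα.le)
      rw [Real.zero_rpow hα.ne'] at h1
      simpa using h1.const_mul (C * (phiHat d ν r)⁻¹)
    refine squeeze_zero' ?_ ?_ hlim
    · filter_upwards [eventually_gt_atTop 0] with x hx
      exact mul_nonneg (hu_nonneg x hx) (H.ν_pos x hx).le
    · filter_upwards [eventually_ge_atTop r] with x hx
      exact hC r x hr hx
  have hparts := integral_Ioi_mul_deriv_eq_deriv_mul (a := r) (u := u) (v := fun x => -ν x)
    (u' := u') (v' := fun x => -deriv ν x) (a' := -(u r * ν r)) (b' := 0)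
    (fun x hx => hasDerivAt_pow_mul_exp d (b * κ) (hr.trans hx))
    (fun x hx => (H.ν_diff x (hr.trans hx)).hasDerivAt.neg) hv
    (hint.neg.congr_fun (fun x _ => by simp) measurableSet_Ioi)
    (by
      have : ContinuousAt (fun x => u x * ν x) r :=
        hu_cont.continuousAt.mul (H.ν_diff r hr).continuousAt
      exact (this.neg.tendsto.mono_left nhdsWithin_le_nhds).congr fun x => by simp)
    (neg_zero (G := ℝ) ▸ htop.neg.congr fun x => (mul_neg (u x) (ν x)).symm)
  calc _ = ∫ x in Ioi r, u x * -deriv ν x := rfl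
    _ = u r * ν r + ∫ x in Ioi r, u' x * ν x := by
        rw [hparts]
        simp only [mul_neg, integral_neg]
        ring
    _ ≤ C * (phiHat d ν r)⁻¹ + B * (phiHat d ν r)⁻¹ / α₃ := add_le_add hur hle
    _ = _ := by ring

end NuAssumptions

/-- exponential-moment tail bounds for ν and ν₁ in terms of Ψ. -/
theorem exp_tail_bound (d : ℕ) (hd : 0 < d) (ν : ℝ → ℝ) (a b β ℓ a₃ α₃ : ℝ)
    (H : NuAssumptions d ν a b β ℓ a₃ α₃) :
    ∀ κ : ℝ, 0 < κ → κ < 1 → ∃ c : ℝ, 0 < c ∧ ∀ r : ℝ, 0 < r →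
      (∫ y in {y : EuclideanSpace ℝ (Fin d) | r < ‖y‖},
          Real.exp (b * κ * ‖y‖ ^ β) * ν ‖y‖)
        ≤ c * Psi d hd ν (1 / r)
      ∧ (∫ y in {y : EuclideanSpace ℝ (Fin (d + 2)) | r < ‖y‖},
          Real.exp (b * κ * ‖y‖ ^ β) * nu1 ν ‖y‖)
        ≤ c * Psi d hd ν (1 / r) := by
  intro κ hκ0 hκ1
  obtain ⟨C₀, hC₀, hΨ⟩ := H.exists_inv_phiHat_le_Psi hd
  obtain ⟨C₁, hC₁, h₁⟩ := H.exists_integral_exp_mul_le hd hκ0 hκ1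
  obtain ⟨C₂, hC₂, h₂⟩ := H.exists_integral_exp_mul_neg_deriv_le hd hκ0 hκ1
  have hpi := Real.pi_pos
  set A₁ := d * volume.real (Metric.ball (0 : EuclideanSpace ℝ (Fin d)) 1)
  set A₂ := ((d + 2 : ℕ) : ℝ) *
    volume.real (Metric.ball (0 : EuclideanSpace ℝ (Fin (d + 2))) 1) with hA₂
  have hA₁0 : 0 ≤ A₁ := by positivity
  have hA₂0 : 0 ≤ A₂ := by positivity
  refine ⟨A₁ * C₁ * C₀ + A₂ * (2 * Real.pi)⁻¹ * C₂ * C₀ + 1, by positivity, fun r hr => ?_⟩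
  have hΨ0 := H.Psi_nonneg hd (1 / r)
  have hprod₁ : 0 ≤ A₁ * C₁ * C₀ * Psi d hd ν (1 / r) := by positivity
  have hprod₂ : 0 ≤ A₂ * (2 * Real.pi)⁻¹ * C₂ * C₀ * Psi d hd ν (1 / r) := by positivity
  constructor
  · rw [integral_norm_gt_eq d hd (fun s => Real.exp (b * κ * s ^ β) * ν s) hr]
    calc _ ≤ A₁ * (C₁ * (C₀ * Psi d hd ν (1 / r))) := by
          refine mul_le_mul_of_nonneg_left ((h₁ r hr).trans ?_) hA₁0
          exact mul_le_mul_of_nonneg_left (hΨ r hr) hC₁.le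
      _ ≤ _ := by linarith
  · rw [integral_norm_gt_eq (d + 2) (by omega) (fun s => Real.exp (b * κ * s ^ β) * nu1 ν s) hr]
    have heq : ∫ s in Ioi r, s ^ (d + 2 - 1) * (Real.exp (b * κ * s ^ β) * nu1 ν s) =
        (2 * Real.pi)⁻¹ *
          ∫ s in Ioi r, s ^ d * Real.exp (b * κ * s ^ β) * (-deriv ν s) := by
      rw [← integral_const_mul]
      refine setIntegral_congr_fun measurableSet_Ioi fun s hs => ?_
      have hs0 : 0 < s := hr.trans hs
      simp only [nu1, show d + 2 - 1 = d + 1 by omega, pow_succ]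
      field_simp
    rw [heq, ← hA₂]
    calc _ ≤ A₂ * ((2 * Real.pi)⁻¹ * (C₂ * (C₀ * Psi d hd ν (1 / r)))) := by
          refine mul_le_mul_of_nonneg_left (mul_le_mul_of_nonneg_left ((h₂ r hr).trans ?_)
            (by positivity)) hA₂0
          exact mul_le_mul_of_nonneg_left (hΨ r hr) hC₂.le
      _ ≤ _ := by linarith
end
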